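/- arXiv:1802.03377 — 10 statements merged into one kernel-verified Lean document; each statement's English description precedes it below -/
import Mathlib

section
/- Let k ∈ ℝ. If α, β ∈ C_k, then their Dirichlet convolution α·β belongs to C_k. -/
open Complex Filter Topology

noncomputable section

/-- The open half-plane `Re z > k`. -/
def HalfPlane (k : ℝ) : Set ℂ := {z : ℂ | k < z.re}

/-- Membership in `O_k`: holomorphic on the half-plane `Re z > k`. -/
def MemOk (k : ℝ) (f : ℂ → ℂ) : Prop := DifferentiableOn ℂ f (HalfPlane k)

/-- Membership in `C_k`. -/
def MemCk (k : ℝ) (α : ℕ → ℂ → ℂ) : Prop :=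
  (∀ n : ℕ, 1 ≤ n → MemOk k (α n)) ∧
  ∀ ε : ℝ, 0 < ε → ∃ M : ℂ → ℝ, ContinuousOn M (HalfPlane k) ∧
    (∀ z ∈ HalfPlane k, 0 ≤ M z) ∧
    ∀ n : ℕ, 1 ≤ n → ∀ z ∈ HalfPlane k, ‖α n z‖ ≤ (n : ℝ) ^ (k + ε) * M z

/-- Dirichlet convolution of two sequences of functions:
`(α·β)(n)(z) = ∑_{ab=n} α(a)(z) β(b)(z)`. -/
def dconv (α β : ℕ → ℂ → ℂ) : ℕ → ℂ → ℂ :=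
  fun n z => ∑ p ∈ n.divisorsAntidiagonal, α p.1 z * β p.2 z

theorem natCast_add_one_le_mul_two_rpow {ε : ℝ} (hε : 0 < ε) (v : ℕ) :
    (v : ℝ) + 1 ≤ (1 + 1 / (ε * Real.log 2)) * (2 : ℝ) ^ (ε * v) := by
  have hlog : 0 < Real.log 2 := Real.log_pos one_lt_two
  have hexp : ε * Real.log 2 * v + 1 ≤ (2 : ℝ) ^ (ε * v) := by
    rw [Real.rpow_def_of_pos two_pos]
    refine le_trans (le_of_eq ?_) (Real.add_one_le_exp _)
    ring
  have hA : (0 : ℝ) ≤ 1 + 1 / (ε * Real.log 2) := by positivity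
  refine le_trans ?_ (mul_le_mul_of_nonneg_left hexp hA)
  have hexpand : (1 + 1 / (ε * Real.log 2)) * (ε * Real.log 2 * v + 1)
      = v + 1 + (ε * Real.log 2 * v + 1 / (ε * Real.log 2)) := by
    field_simp
    ring
  rw [hexpand]
  exact le_add_of_nonneg_right (by positivity)

/-- The divisor bound `d(n) = O(n ^ ε)`. -/
theorem exists_card_divisors_le_mul_rpow {ε : ℝ} (hε : 0 < ε) :
    ∃ C : ℝ, 0 ≤ C ∧ ∀ n : ℕ, n ≠ 0 → (n.divisors.card : ℝ) ≤ C * (n : ℝ) ^ ε := by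
  obtain ⟨B, hB⟩ := exists_nat_ge ((2 : ℝ) ^ (1 / ε))
  set A : ℝ := 1 + 1 / (ε * Real.log 2)
  have hA : 1 ≤ A := by
    have : 0 < Real.log 2 := Real.log_pos one_lt_two
    exact le_add_of_nonneg_right (by positivity)
  have hA0 : 0 ≤ A := zero_le_one.trans hA
  have hfactor (p v : ℕ) (hp : p.Prime) :
      (v : ℝ) + 1 ≤ (if p < B then A else 1) * ((p : ℝ) ^ v) ^ ε := by
    have hp2 : (2 : ℝ) ≤ p := by exact_mod_cast hp.two_le
    split_ifs with hpB
    · refine (natCast_add_one_le_mul_two_rpow hε v).trans ?_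
      rw [← Real.rpow_natCast, ← Real.rpow_mul (by positivity), mul_comm (v : ℝ)]
      gcongr
    · have hpε : (2 : ℝ) ≤ (p : ℝ) ^ ε := by
        have hle : (2 : ℝ) ^ (1 / ε) ≤ p := hB.trans (by exact_mod_cast not_lt.mp hpB)
        calc (2 : ℝ) = ((2 : ℝ) ^ (1 / ε)) ^ ε := by
              rw [← Real.rpow_mul two_pos.le, one_div_mul_cancel hε.ne', Real.rpow_one]
          _ ≤ (p : ℝ) ^ ε := by gcongr
      rw [one_mul, ← Real.rpow_pow_comm (by positivity)]
      calc (v : ℝ) + 1 ≤ 2 ^ v := by exact_mod_cast Nat.lt_two_pow_self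
        _ ≤ _ := by gcongr
  refine ⟨A ^ B, by positivity, fun n hn => ?_⟩
  have hprod : (n : ℝ) ^ ε
      = ∏ p ∈ n.primeFactors, ((p : ℝ) ^ n.factorization p) ^ ε := by
    rw [Real.finsetProd_rpow _ _ fun p _ => by positivity]
    congr 1
    exact_mod_cast (Nat.prod_factorization_pow_eq_self hn).symm
  have hconst : ∏ p ∈ n.primeFactors, (if p < B then A else 1) ≤ A ^ B := by
    rw [← Finset.prod_filter, Finset.prod_const]
    refine pow_le_pow_right₀ hA ?_
    refine (Finset.card_le_card (t := Finset.range B) fun p hp => ?_).trans_eq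
      (Finset.card_range B)
    exact Finset.mem_range.mpr (Finset.mem_filter.mp hp).2
  rw [Nat.card_divisors hn, hprod]
  push_cast
  calc ∏ p ∈ n.primeFactors, ((n.factorization p : ℝ) + 1)
      ≤ ∏ p ∈ n.primeFactors,
          (if p < B then A else 1) * ((p : ℝ) ^ n.factorization p) ^ ε :=
        Finset.prod_le_prod (fun p _ => by positivity)
          fun p hp => hfactor p _ (Nat.prime_of_mem_primeFactors hp)
    _ = (∏ p ∈ n.primeFactors, (if p < B then A else 1)) *
          ∏ p ∈ n.primeFactors, ((p : ℝ) ^ n.factorization p) ^ ε := Finset.prod_mul_distrib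
    _ ≤ _ := mul_le_mul_of_nonneg_right hconst
          (Finset.prod_nonneg fun p _ => by positivity)

/-- `C_k` is closed under Dirichlet convolution. -/
theorem statement_1 (k : ℝ) (α β : ℕ → ℂ → ℂ) (hα : MemCk k α) (hβ : MemCk k β) :
    MemCk k (dconv α β) := by
  refine ⟨fun n _ => DifferentiableOn.fun_sum fun p hp => ?_, fun ε hε => ?_⟩
  · have hp0 := Nat.ne_zero_of_mem_divisorsAntidiagonal hp
    exact (hα.1 _ (Nat.one_le_iff_ne_zero.mpr hp0.1)).mul
      (hβ.1 _ (Nat.one_le_iff_ne_zero.mpr hp0.2))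
  obtain ⟨M, hMc, hM0, hM⟩ := hα.2 (ε / 2) (half_pos hε)
  obtain ⟨N, hNc, hN0, hN⟩ := hβ.2 (ε / 2) (half_pos hε)
  obtain ⟨C, hC0, hC⟩ := exists_card_divisors_le_mul_rpow (half_pos hε)
  refine ⟨fun z => C * (M z * N z), continuousOn_const.mul (hMc.mul hNc),
    fun z hz => mul_nonneg hC0 (mul_nonneg (hM0 z hz) (hN0 z hz)), fun n hn z hz => ?_⟩
  have hn0 : (0 : ℝ) < n := by exact_mod_cast hn
  have hMN : 0 ≤ M z * N z := mul_nonneg (hM0 z hz) (hN0 z hz)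
  have hterm : ∀ p ∈ n.divisorsAntidiagonal,
      ‖α p.1 z * β p.2 z‖ ≤ (n : ℝ) ^ (k + ε / 2) * (M z * N z) := by
    intro p hp
    have hp0 := Nat.ne_zero_of_mem_divisorsAntidiagonal hp
    have hpn : (n : ℝ) = p.1 * p.2 := by
      exact_mod_cast (Nat.mem_divisorsAntidiagonal.mp hp).1.symm
    rw [norm_mul, hpn, Real.mul_rpow (by positivity) (by positivity), mul_mul_mul_comm]
    exact mul_le_mul (hM _ (Nat.one_le_iff_ne_zero.mpr hp0.1) z hz)
      (hN _ (Nat.one_le_iff_ne_zero.mpr hp0.2) z hz) (norm_nonneg _)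
      (mul_nonneg (by positivity) (hM0 z hz))
  calc ‖dconv α β n z‖
      ≤ n.divisorsAntidiagonal.card • ((n : ℝ) ^ (k + ε / 2) * (M z * N z)) :=
        (norm_sum_le _ _).trans (Finset.sum_le_card_nsmul _ _ _ hterm)
    _ = (n.divisors.card : ℝ) * ((n : ℝ) ^ (k + ε / 2) * (M z * N z)) := by
        rw [nsmul_eq_mul, ← Nat.map_div_right_divisors, Finset.card_map]
    _ ≤ C * (n : ℝ) ^ (ε / 2) * ((n : ℝ) ^ (k + ε / 2) * (M z * N z)) :=
        mul_le_mul_of_nonneg_right (hC n (by lia)) (mul_nonneg (by positivity) hMN)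
    _ = (n : ℝ) ^ (k + ε) * (C * (M z * N z)) := by
        rw [show k + ε = ε / 2 + (k + ε / 2) by ring, Real.rpow_add hn0 (ε / 2)]
        ring
end
end

section
/- Let k ∈ ℝ. The ideal I_k of the ring B_k is not finitely generated: there is no finite set f_1, …, f_m ∈ I_k such that every f ∈ I_k can be written as f = g_1 f_1 + ⋯ + g_m f_m with g_1, …, g_m ∈ B_k. -/
open Complex Filter Topology

noncomputable section

/-- Membership in `B_k`: holomorphic on `Re z > k`, with `e^(-ax)|f(x)| → 0` as `x → +∞`
along the real axis, for every `a > 0`. -/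
def MemBk (k : ℝ) (f : ℂ → ℂ) : Prop :=
  MemOk k f ∧ ∀ a : ℝ, 0 < a →
    Tendsto (fun x : ℝ => Real.exp (-a * x) * ‖f (x : ℂ)‖) atTop (nhds 0)

/-- Membership in `I_k`: holomorphic on `Re z > k`, with `e^(ax)|f(x)| → 0` as `x → +∞`
along the real axis, for some `a > 0`. -/
def MemIk (k : ℝ) (f : ℂ → ℂ) : Prop :=
  MemOk k f ∧ ∃ a : ℝ, 0 < a ∧
    Tendsto (fun x : ℝ => Real.exp (a * x) * ‖f (x : ℂ)‖) atTop (nhds 0)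

/-- For `c > 0` the function `exp (-c z)` belongs to `I_k`. -/
lemma memIk_exp_neg_mul (k : ℝ) {c : ℝ} (hc : 0 < c) :
    MemIk k (fun z => Complex.exp (-c * z)) := by
  refine ⟨Differentiable.differentiableOn (by fun_prop), c / 2, half_pos hc, ?_⟩
  have hlim : Tendsto (fun x : ℝ => Real.exp (-(c / 2 * x))) atTop (nhds 0) :=
    Real.tendsto_exp_neg_atTop_nhds_zero.comp (tendsto_id.const_mul_atTop (half_pos hc))
  refine hlim.congr fun x => ?_
  rw [Complex.norm_exp, ← Real.exp_add]
  congr 1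
  simp
  ring

/-- If `e^(ax)|f(x)| → 0` and `g ∈ B_k`, then `e^(cx)|g(x) f(x)| → 0` for every `c < a`. -/
lemma MemBk.tendsto_exp_mul_norm_mul {k a c : ℝ} {f g : ℂ → ℂ} (hg : MemBk k g) (hca : c < a)
    (hf : Tendsto (fun x : ℝ => Real.exp (a * x) * ‖f (x : ℂ)‖) atTop (nhds 0)) :
    Tendsto (fun x : ℝ => Real.exp (c * x) * ‖g (x : ℂ) * f (x : ℂ)‖) atTop (nhds 0) := by
  have hmul := (hg.2 (a - c) (sub_pos.2 hca)).mul hf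
  rw [mul_zero] at hmul
  refine hmul.congr fun x => ?_
  rw [norm_mul, mul_mul_mul_comm, ← Real.exp_add]
  ring_nf

/-- the ideal `I_k` of `B_k` is not finitely generated: there is no finite
family `f_1, …, f_m ∈ I_k` such that every `f ∈ I_k` is `g_1 f_1 + ⋯ + g_m f_m` with the
`g_i ∈ B_k` (equality as functions on the half-plane `Re z > k`). -/
theorem statement_11 (k : ℝ) :
    ¬ ∃ (m : ℕ) (f : Fin m → ℂ → ℂ), (∀ i, MemIk k (f i)) ∧
      ∀ h : ℂ → ℂ, MemIk k h → ∃ g : Fin m → ℂ → ℂ, (∀ i, MemBk k (g i)) ∧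
        ∀ z ∈ HalfPlane k, h z = ∑ i, g i z * f i z := by
  rintro ⟨m, f, hf, hgen⟩
  choose a ha hfa using fun i => (hf i).2
  obtain ⟨c, hca, hc⟩ : ∃ c : ℝ, (∀ i, c < a i) ∧ 0 < c :=
    ((eventually_all.2 fun i => (eventually_lt_nhds (ha i)).filter_mono nhdsWithin_le_nhds).and
      (self_mem_nhdsWithin : Set.Ioi (0 : ℝ) ∈ 𝓝[>] 0)).exists
  obtain ⟨g, hg, hsum⟩ := hgen _ (memIk_exp_neg_mul k hc)
  have hlim : Tendsto (fun x : ℝ => ∑ i, Real.exp (c * x) * ‖g i x * f i x‖) atTop (nhds 0) := by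
    simpa using tendsto_finsetSum Finset.univ
      fun i _ => (hg i).tendsto_exp_mul_norm_mul (hca i) (hfa i)
  obtain ⟨x, hx, hkx⟩ :=
    ((hlim.eventually (eventually_lt_nhds zero_lt_one)).and (eventually_gt_atTop k)).exists
  have hnorm : ‖Complex.exp (-c * x)‖ = Real.exp (-(c * x)) := by
    rw [Complex.norm_exp]
    simp
  have hle := norm_sum_le Finset.univ fun i => g i x * f i x
  rw [← hsum x (by simpa [HalfPlane] using hkx), hnorm] at hle
  have hone := mul_le_mul_of_nonneg_left hle (Real.exp_pos (c * x)).le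
  rw [← Real.exp_add, add_neg_cancel, Real.exp_zero, Finset.mul_sum] at hone
  exact hone.not_gt hx
end
end

section
/- Let k ∈ ℝ. There exist functions f, h ∈ B_k with f ∉ I_k, h ∉ I_k, but f·h ∈ I_k. Consequently, I_k is not a prime ideal of B_k. -/
open Complex Filter Topology

noncomputable section

/-- The entire function `z ↦ exp (-z (1 + cos (z + θ)))`. On the positive real axis it is bounded
by `1`, and it takes the value `1` at arbitrarily large real points. -/
def oscExp (θ : ℝ) (z : ℂ) : ℂ := Complex.exp (-z * (1 + Complex.cos (z + θ)))

lemma memOk_oscExp (k θ : ℝ) : MemOk k (oscExp θ) := by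
  have h : Differentiable ℂ (oscExp θ) := by
    unfold oscExp
    fun_prop
  exact h.differentiableOn

lemma norm_oscExp_ofReal (θ x : ℝ) :
    ‖oscExp θ (x : ℂ)‖ = Real.exp (-x * (1 + Real.cos (x + θ))) := by
  have h : oscExp θ (x : ℂ) = ((Real.exp (-x * (1 + Real.cos (x + θ))) : ℝ) : ℂ) := by
    simp [oscExp]
  rw [h, Complex.norm_real, Real.norm_of_nonneg (Real.exp_pos _).le]

lemma tendsto_exp_neg_mul_atTop {a : ℝ} (ha : 0 < a) :
    Tendsto (fun x : ℝ => Real.exp (-a * x)) atTop (nhds 0) :=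
  Real.tendsto_exp_atBot.comp (tendsto_id.const_mul_atTop_of_neg (neg_lt_zero.mpr ha))

lemma memBk_oscExp (k θ : ℝ) : MemBk k (oscExp θ) := by
  refine ⟨memOk_oscExp k θ, fun a ha => ?_⟩
  refine squeeze_zero' (Eventually.of_forall fun x => by positivity) ?_
    (tendsto_exp_neg_mul_atTop ha)
  filter_upwards [eventually_ge_atTop 0] with x hx
  refine mul_le_of_le_one_right (Real.exp_pos _).le ?_
  rw [norm_oscExp_ofReal, Real.exp_le_one_iff]
  nlinarith [Real.neg_one_le_cos (x + θ)]

lemma not_memIk_oscExp (k θ : ℝ) : ¬ MemIk k (oscExp θ) := by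
  rintro ⟨-, a, ha, hlim⟩
  have hu : Tendsto (fun n : ℕ => (n : ℝ) * (2 * Real.pi) + (Real.pi - θ)) atTop atTop :=
    tendsto_atTop_add_const_right _ _
      (tendsto_natCast_atTop_atTop.atTop_mul_const Real.two_pi_pos)
  have hexp := Real.tendsto_exp_atTop.comp (hu.const_mul_atTop ha)
  refine not_tendsto_nhds_of_tendsto_atTop hexp 0 ((hlim.comp hu).congr fun n => ?_)
  have hcos : Real.cos ((n : ℝ) * (2 * Real.pi) + (Real.pi - θ) + θ) = -1 := by
    rw [add_assoc, sub_add_cancel, Real.cos_add_pi, Real.cos_nat_mul_two_pi]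
  simp only [Function.comp_apply, norm_oscExp_ofReal, hcos]
  simp

lemma norm_oscExp_zero_mul_oscExp_pi (x : ℝ) :
    ‖oscExp 0 (x : ℂ) * oscExp Real.pi (x : ℂ)‖ = Real.exp (-2 * x) := by
  rw [norm_mul, norm_oscExp_ofReal, norm_oscExp_ofReal, ← Real.exp_add, Real.cos_add_pi, add_zero]
  congr 1
  ring

/-- there exist `f, h ∈ B_k` with `f ∉ I_k`, `h ∉ I_k`, but `f·h ∈ I_k`;
consequently `I_k` is not a prime ideal of `B_k`. -/
theorem statement_12 (k : ℝ) :
    ∃ f h : ℂ → ℂ, MemBk k f ∧ ¬ MemIk k f ∧ MemBk k h ∧ ¬ MemIk k h ∧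
      MemIk k (fun z => f z * h z) := by
  refine ⟨oscExp 0, oscExp Real.pi, memBk_oscExp k _, not_memIk_oscExp k _, memBk_oscExp k _,
    not_memIk_oscExp k _, (memOk_oscExp k _).mul (memOk_oscExp k _), 1, one_pos, ?_⟩
  refine (tendsto_exp_neg_mul_atTop one_pos).congr fun x => ?_
  rw [norm_oscExp_zero_mul_oscExp_pi, ← Real.exp_add]
  congr 1
  ring
end
end

section
/- Let f : ℂ → ℂ be an entire function such that there exist constants ρ < 1 and A, B > 0 with |f(z)| ≤ A e^{B|z|^ρ} for all z ∈ ℂ (i.e., f has order of growth < 1). Then for every k ∈ ℝ the restriction of f to {Re z > k} belongs to B_k; and if this restriction belongs to I_k, then f is identically zero. -/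
open Complex Filter Topology

noncomputable section

/-- A continuous function of order of growth `< 1` has minimal exponential type. -/
theorem exists_norm_le_mul_exp_of_order_lt_one {f : ℂ → ℂ} (hf : Continuous f) {ρ A B : ℝ}
    (hρ : ρ < 1) (hA : 0 < A) (hgrowth : ∀ z : ℂ, ‖f z‖ ≤ A * Real.exp (B * ‖z‖ ^ ρ))
    {ε : ℝ} (hε : 0 < ε) : ∃ C : ℝ, 0 < C ∧ ∀ z : ℂ, ‖f z‖ ≤ C * Real.exp (ε * ‖z‖) := by
  have hlim : Tendsto (fun r : ℝ => B * r ^ (-(1 - ρ))) atTop (𝓝 0) := by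
    simpa using (tendsto_rpow_neg_atTop (sub_pos.2 hρ)).const_mul B
  obtain ⟨R, hR⟩ := eventually_atTop.1 ((hlim.eventually_le_const hε).and (eventually_gt_atTop 0))
  obtain ⟨M, hM⟩ := (isCompact_closedBall (0 : ℂ) R).exists_bound_of_continuousOn hf.continuousOn
  refine ⟨max A M, lt_max_of_lt_left hA, fun z => ?_⟩
  rcases le_total ‖z‖ R with hz | hz
  · calc ‖f z‖ ≤ max A M := (hM z (by simpa using hz)).trans (le_max_right _ _)
      _ ≤ max A M * Real.exp (ε * ‖z‖) :=
        le_mul_of_one_le_right (hA.le.trans (le_max_left _ _)) (Real.one_le_exp (by positivity))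
  · obtain ⟨hle, hpos⟩ := hR _ hz
    have key : B * ‖z‖ ^ ρ ≤ ε * ‖z‖ := by
      calc B * ‖z‖ ^ ρ = B * ‖z‖ ^ (-(1 - ρ)) * ‖z‖ := by
            rw [mul_assoc, ← Real.rpow_add_one hpos.ne']
            congr 2
            ring
        _ ≤ ε * ‖z‖ := by gcongr
    refine (hgrowth z).trans ?_
    gcongr
    exact le_max_left _ _

theorem neg_pi_div_two_mul_abs_im_le_re_add_one_mul_log {z : ℂ} (hz : 0 ≤ z.re) :
    -(Real.pi / 2 * |z.im|) ≤ ((z + 1) * log (z + 1)).re := by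
  have hre : (z + 1).re = z.re + 1 := by simp
  have hnorm : 1 ≤ ‖z + 1‖ := by
    linarith [re_le_norm (z + 1)]
  have harg : |(z + 1).arg| ≤ Real.pi / 2 := abs_arg_le_pi_div_two_iff.2 (by linarith)
  have him : z.im * (z + 1).arg ≤ Real.pi / 2 * |z.im| := by
    calc z.im * (z + 1).arg ≤ |z.im| * |(z + 1).arg| := by
          rw [← abs_mul]; exact le_abs_self _
      _ ≤ |z.im| * (Real.pi / 2) := by gcongr
      _ = _ := mul_comm _ _
  have hlog : 0 ≤ (z.re + 1) * Real.log ‖z + 1‖ :=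
    mul_nonneg (by linarith) (Real.log_nonneg hnorm)
  rw [mul_re, hre, log_re, log_im, add_im, one_im, add_zero]
  linarith

/-- A function of exponential type on the right half-plane that decays exponentially in both
directions along the imaginary axis vanishes identically. -/
theorem eqOn_zero_right_half_plane_of_exp_decay_imaginary_axis {g : ℂ → ℂ}
    (hg : DiffContOnCl ℂ g {z | 0 < z.re}) {C τ b : ℝ} (hb : 0 < b)
    (htype : ∀ z : ℂ, 0 ≤ z.re → ‖g z‖ ≤ C * Real.exp (τ * ‖z‖))
    (him : ∀ y : ℝ, ‖g (y * I)‖ ≤ C * Real.exp (-b * |y|)) :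
    Set.EqOn g 0 {z | 0 ≤ z.re} := by
  have hC : 0 ≤ C := by simpa using (norm_nonneg _).trans (htype 0 le_rfl)
  set c : ℝ := 2 * b / Real.pi with hc
  have hc0 : 0 < c := by positivity
  have hcpi : c * (Real.pi / 2) = b := by rw [hc]; field_simp
  set m : ℂ → ℂ := fun z => exp (-(c * ((z + 1) * log (z + 1)))) with hm
  have hm_norm : ∀ z, ‖m z‖ = Real.exp (-(c * ((z + 1) * log (z + 1)).re)) := fun z => by
    rw [hm, norm_exp, neg_re, re_ofReal_mul]
  have hm_le : ∀ z : ℂ, 0 ≤ z.re → ‖m z‖ ≤ Real.exp (b * |z.im|) := fun z hz => by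
    rw [hm_norm, Real.exp_le_exp, ← hcpi]
    nlinarith [neg_pi_div_two_mul_abs_im_le_re_add_one_mul_log hz]
  have hm_diff : DiffContOnCl ℂ m {z | 0 < z.re} := by
    apply DifferentiableOn.diffContOnCl
    rw [closure_setOfPred_lt_re]
    intro z (hz : 0 ≤ z.re)
    have hslit : z + 1 ∈ slitPlane := Or.inl (by simp; linarith)
    have hz1 : DifferentiableAt ℂ (fun z : ℂ => z + 1) z := by fun_prop
    exact (((hz1.mul (hz1.clog hslit)).const_mul _).neg.cexp).differentiableWithinAt
  have hzero := PhragmenLindelof.eq_zero_on_right_half_plane_of_superexponential_decay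
    (f := fun z => m z • g z) (hm_diff.smul hg) ?_ ?_ ?_
  · intro z hz
    simpa [hm] using hzero hz
  · refine ⟨1, one_lt_two, b + τ, .of_bound C ?_⟩
    refine eventually_inf_principal.2 <| Eventually.of_forall fun z (hz : 0 < z.re) => ?_
    rw [Real.rpow_one, Real.norm_of_nonneg (Real.exp_pos _).le, norm_smul, add_mul, Real.exp_add]
    calc ‖m z‖ * ‖g z‖ ≤ Real.exp (b * ‖z‖) * (C * Real.exp (τ * ‖z‖)) := by
          gcongr
          · exact (hm_le z hz.le).trans (by gcongr; exact abs_im_le_norm z)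
          · exact htype z hz.le
      _ = _ := by ring
  · intro n
    have hexpo : Tendsto (fun x : ℝ => (x + 1) * (n + |τ| - c * Real.log (x + 1)))
        atTop atBot := by
      have hadd : Tendsto (fun x : ℝ => x + 1) atTop atTop :=
        tendsto_atTop_add_const_right _ _ tendsto_id
      refine hadd.atTop_mul_atBot₀ ?_
      simp only [sub_eq_add_neg]
      exact tendsto_atBot_add_const_left _ _
        (tendsto_neg_atTop_atBot.comp ((Real.tendsto_log_atTop.comp hadd).const_mul_atTop hc0))
    have hbound := (Real.tendsto_exp_atBot.comp hexpo).const_mul C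
    rw [mul_zero] at hbound
    refine squeeze_zero' (Eventually.of_forall fun x => by positivity) ?_ hbound
    filter_upwards [eventually_ge_atTop 0] with x hx
    have hmx : ‖m x‖ = Real.exp (-(c * ((x + 1) * Real.log (x + 1)))) := by
      have hcast : ((x : ℂ) + 1) * log ((x : ℂ) + 1) = (((x + 1) * Real.log (x + 1) : ℝ) : ℂ) := by
        rw [ofReal_mul, ofReal_log (by linarith)]; push_cast; rfl
      rw [hm_norm, hcast, ofReal_re]
    have hgx : ‖g x‖ ≤ C * Real.exp (τ * x) := by
      simpa [abs_of_nonneg hx] using htype x (by simpa using hx)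
    rw [norm_smul, hmx, ← Real.exp_nat_mul, Function.comp_apply]
    calc Real.exp (n * x) * (Real.exp (-(c * ((x + 1) * Real.log (x + 1)))) * ‖g x‖)
        ≤ Real.exp (n * x) * (Real.exp (-(c * ((x + 1) * Real.log (x + 1)))) *
          (C * Real.exp (τ * x))) := by gcongr
      _ = C * Real.exp (n * x + -(c * ((x + 1) * Real.log (x + 1))) + τ * x) := by
          rw [Real.exp_add, Real.exp_add]; ring
      _ ≤ _ := by
          gcongr
          have hτ : τ * x ≤ |τ| * x := by gcongr; exact le_abs_self τ
          have hn : (0 : ℝ) ≤ n := n.cast_nonneg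
          linarith [abs_nonneg τ]
  · refine ⟨C, fun y => ?_⟩
    have hmy : ‖m (y * I)‖ ≤ Real.exp (b * |y|) := by simpa using hm_le (y * I) (by simp)
    rw [norm_smul]
    calc ‖m (y * I)‖ * ‖g (y * I)‖ ≤ Real.exp (b * |y|) * (C * Real.exp (-b * |y|)) := by
          gcongr
          exact him y
      _ = C := by
          rw [mul_left_comm, ← Real.exp_add]
          simp

/-- An entire function of minimal exponential type that decays exponentially along the positive
real axis vanishes identically. -/
theorem eq_zero_of_minimal_type_of_exp_decay {f : ℂ → ℂ} (hf : Differentiable ℂ f)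
    (htype : ∀ ε : ℝ, 0 < ε → ∃ C : ℝ, 0 < C ∧ ∀ z : ℂ, ‖f z‖ ≤ C * Real.exp (ε * ‖z‖))
    {a : ℝ} (ha : 0 < a)
    (hdecay : Tendsto (fun x : ℝ => Real.exp (a * x) * ‖f (x : ℂ)‖) atTop (𝓝 0)) :
    f = 0 := by
  obtain ⟨C₁, hC₁, hf₁⟩ := htype (a / 4) (by positivity)
  obtain ⟨R, hR⟩ := eventually_atTop.1 (hdecay.eventually_le_const zero_lt_one)
  obtain ⟨M, hM⟩ := (isCompact_Icc (a := (0 : ℝ)) (b := R)).exists_bound_of_continuousOn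
    (f := fun x : ℝ => Real.exp (a * x) * ‖f (x : ℂ)‖)
    (by have := hf.continuous; fun_prop)
  set C : ℝ := max C₁ (max 1 M) with hC
  have hC0 : 0 < C := lt_max_of_lt_left hC₁
  have hpos : ∀ x : ℝ, 0 ≤ x → Real.exp (a * x) * ‖f x‖ ≤ C := fun x hx => by
    rcases le_total x R with h | h
    · exact (le_abs_self _).trans ((hM x ⟨hx, h⟩).trans
        ((le_max_right _ _).trans (le_max_right _ _)))
    · exact (hR x h).trans ((le_max_left _ _).trans (le_max_right _ _))
  have hfC : ∀ z : ℂ, ‖f z‖ ≤ C * Real.exp (a / 4 * ‖z‖) := fun z =>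
    (hf₁ z).trans (by gcongr; exact le_max_left _ _)
  set g : ℂ → ℂ := fun z => exp ((a / 2 : ℝ) * (z * I)) * f (z * I) with hg
  have hg_norm : ∀ z, ‖g z‖ = Real.exp (a / 2 * (-z.im)) * ‖f (z * I)‖ := fun z => by
    rw [hg, norm_mul, norm_exp, re_ofReal_mul, mul_I_re]
  have hg_diff : Differentiable ℂ g := by
    rw [hg]; fun_prop
  have hzero := eqOn_zero_right_half_plane_of_exp_decay_imaginary_axis (C := C) (τ := a)
    (b := a / 4) hg_diff.diffContOnCl (by positivity) ?_ ?_
  · have hupper : ∀ w : ℂ, 0 < w.im → f w = 0 := fun w hw => by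
      have hmem : -(w * I) ∈ {z : ℂ | 0 ≤ z.re} := by simp [hw.le]
      have hrot : -(w * I) * I = w := by rw [neg_mul, mul_assoc, I_mul_I, mul_neg_one, neg_neg]
      have := hzero hmem
      simp only [hg, hrot, Pi.zero_apply, mul_eq_zero, exp_ne_zero, false_or] at this
      exact this
    refine (hf.differentiableOn.analyticOnNhd isOpen_univ).eq_of_eventuallyEq (z₀ := I) (fun _ _ => analyticAt_const) ?_
    filter_upwards [(isOpen_lt continuous_const continuous_im).mem_nhds
      (show (0 : ℝ) < I.im by simp)] with w hw using hupper w hw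
  · intro z _
    have hz := hfC (z * I)
    rw [norm_mul, norm_I, mul_one] at hz
    rw [hg_norm]
    calc Real.exp (a / 2 * (-z.im)) * ‖f (z * I)‖
        ≤ Real.exp (a / 2 * ‖z‖) * (C * Real.exp (a / 4 * ‖z‖)) := by
          gcongr
          exact (neg_le_abs _).trans (abs_im_le_norm z)
      _ = C * Real.exp (a / 2 * ‖z‖ + a / 4 * ‖z‖) := by rw [Real.exp_add]; ring
      _ ≤ C * Real.exp (a * ‖z‖) := by
          gcongr
          nlinarith [norm_nonneg z]
  · intro y
    have hyI : (y : ℂ) * I * I = ((-y : ℝ) : ℂ) := by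
      rw [mul_assoc, I_mul_I]; push_cast; ring
    rw [hg_norm, hyI, mul_I_im, ofReal_re]
    rcases le_total 0 y with hy | hy
    · have hfy := hfC ((-y : ℝ) : ℂ)
      rw [norm_real, Real.norm_eq_abs, abs_neg, abs_of_nonneg hy] at hfy
      rw [abs_of_nonneg hy]
      calc Real.exp (a / 2 * -y) * ‖f ((-y : ℝ) : ℂ)‖
          ≤ Real.exp (a / 2 * -y) * (C * Real.exp (a / 4 * y)) := by gcongr
        _ = C * Real.exp (-(a / 4) * y) := by
          rw [mul_left_comm, ← Real.exp_add]
          ring_nf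
    · rw [abs_of_nonpos hy]
      calc Real.exp (a / 2 * -y) * ‖f ((-y : ℝ) : ℂ)‖
          = Real.exp (-(a / 2) * -y) * (Real.exp (a * -y) * ‖f ((-y : ℝ) : ℂ)‖) := by
            rw [← mul_assoc, ← Real.exp_add]
            ring_nf
        _ ≤ Real.exp (-(a / 4) * -y) * C := by
            gcongr
            · linarith
            · linarith
            · exact hpos _ (by linarith)
        _ = _ := mul_comm _ _

/-- an entire function of order of growth `< 1` restricts into `B_k` for every
`k`, and if its restriction lies in `I_k` then it is identically zero. -/
theorem statement_13 (f : ℂ → ℂ) (hf : Differentiable ℂ f)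
    (hgrowth : ∃ ρ A B : ℝ, ρ < 1 ∧ 0 < A ∧ 0 < B ∧
      ∀ z : ℂ, ‖f z‖ ≤ A * Real.exp (B * ‖z‖ ^ ρ)) :
    ∀ k : ℝ, MemBk k f ∧ (MemIk k f → ∀ z : ℂ, f z = 0) := by
  obtain ⟨ρ, A, B, hρ, hA, -, hbound⟩ := hgrowth
  have htype : ∀ ε : ℝ, 0 < ε → ∃ C : ℝ, 0 < C ∧ ∀ z : ℂ, ‖f z‖ ≤ C * Real.exp (ε * ‖z‖) :=
    fun ε hε => exists_norm_le_mul_exp_of_order_lt_one hf.continuous hρ hA hbound hε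
  refine fun k => ⟨⟨hf.differentiableOn, fun a ha => ?_⟩, ?_⟩
  · obtain ⟨C, -, hfC⟩ := htype (a / 2) (by positivity)
    have hlim : Tendsto (fun x : ℝ => C * Real.exp (-(a / 2) * x)) atTop (𝓝 0) := by
      simpa using (Real.tendsto_exp_atBot.comp
        (tendsto_id.const_mul_atTop_of_neg (by linarith : -(a / 2) < 0))).const_mul C
    refine squeeze_zero' (Eventually.of_forall fun x => by positivity) ?_ hlim
    filter_upwards [eventually_ge_atTop 0] with x hx
    have hfx := hfC x
    rw [norm_real, Real.norm_of_nonneg hx] at hfx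
    calc Real.exp (-a * x) * ‖f x‖ ≤ Real.exp (-a * x) * (C * Real.exp (a / 2 * x)) := by gcongr
      _ = C * Real.exp (-(a / 2) * x) := by
        rw [mul_left_comm, ← Real.exp_add]
        ring_nf
  · rintro ⟨-, a, ha, hdecay⟩ z
    rw [eq_zero_of_minimal_type_of_exp_decay hf htype ha hdecay, Pi.zero_apply]
end
end

section
/- Let k ∈ ℝ and let α : ℕ≥1 → O_k be a sequence such that for every n ≥ 1, if α(n) ∈ I_k then α(n) = 0. Assume there is a continuous function M : {Re z > k} → [0,∞) such that (i) |α(n)(z)| ≤ M(z) n^k for all n ≥ 1 and Re z > k, and (ii) for every a > 0, e^{−ax} M(x) → 0 as x → +∞ along the real axis. Let L ∈ Ẽ_k and suppose there exists k' ≥ k such that the series F_L(α)(z) = ∑_{n=1}^∞ α(n)(z) L(n)(z) converges absolutely and equals 0 for every z with Re z > k'. Then α(n) = 0 for every n ≥ 1. -/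
open Complex Filter Topology

noncomputable section

/-- Membership in `E_k`: there are `c > 0` and a continuous `C : {Re z > k} → [0,∞)` with
`|L(n)(z)| ≤ C(z) n^(-c·Re z)` for all `n ≥ 1`, `Re z > k`. -/
def MemEk (k : ℝ) (L : ℕ → ℂ → ℂ) : Prop :=
  (∀ n : ℕ, 1 ≤ n → MemOk k (L n)) ∧
  ∃ c : ℝ, 0 < c ∧ ∃ C : ℂ → ℝ, ContinuousOn C (HalfPlane k) ∧
    (∀ z ∈ HalfPlane k, 0 ≤ C z) ∧
    ∀ n : ℕ, 1 ≤ n → ∀ z ∈ HalfPlane k, ‖L n z‖ ≤ C z * (n : ℝ) ^ (-(c * z.re))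


/-- Membership in `Ẽ_k`: `L ∈ E_k`, nowhere vanishing on `Re z > k`, and for every `n₀ ≥ 1`
there is `C(n₀) > 0` with `|L(n)(z)|/|L(n₀)(z)| ≤ n^(-C(n₀)·Re z)` for `n ≥ n₀+1`, `Re z > k`. -/
def MemEtk (k : ℝ) (L : ℕ → ℂ → ℂ) : Prop :=
  MemEk k L ∧ (∀ n : ℕ, 1 ≤ n → ∀ z ∈ HalfPlane k, L n z ≠ 0) ∧
  ∀ n₀ : ℕ, 1 ≤ n₀ → ∃ C : ℝ, 0 < C ∧ ∀ n : ℕ, n₀ + 1 ≤ n → ∀ z ∈ HalfPlane k,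
    ‖L n z‖ / ‖L n₀ z‖ ≤ (n : ℝ) ^ (-(C * z.re))

theorem rpow_le_two_rpow_mul_rpow_neg_two {x s : ℝ} (hx : 2 ≤ x) (hs : s + 2 ≤ 0) :
    x ^ s ≤ (2 : ℝ) ^ (s + 2) * x ^ (-2 : ℝ) := by
  have hpos : 0 < x := by linarith
  calc x ^ s = x ^ (s + 2) * x ^ (-2 : ℝ) := by
        rw [← Real.rpow_add hpos]; ring_nf
    _ ≤ _ := mul_le_mul_of_nonneg_right
        (Real.rpow_le_rpow_of_nonpos (by norm_num) hx hs) (Real.rpow_nonneg hpos.le _)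

/-- If a series vanishes, a single term is bounded by any majorant of the others. -/
theorem norm_le_tsum_of_tsum_eq_zero {f : ℕ → ℂ} {g : ℕ → ℝ} (hf : Summable f)
    (h0 : ∑' n, f n = 0) (hg : Summable g) (hg0 : ∀ n, 0 ≤ g n) (m : ℕ)
    (hfg : ∀ n, n ≠ m → ‖f n‖ ≤ g n) : ‖f m‖ ≤ ∑' n, g n := by
  rw [hf.tsum_eq_add_tsum_ite m] at h0
  rw [eq_neg_of_add_eq_zero_left h0, norm_neg]
  refine tsum_of_norm_bounded hg.hasSum fun n => ?_
  split_ifs with h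
  · simpa using hg0 n
  · exact hfg n h

/-- Lemma 2.6(2): let `α : ℕ≥1 → O_k` with `α(n) ∈ I_k ⇒ α(n) = 0`, bounded by
`|α(n)(z)| ≤ M(z) n^k` with `M` continuous and `e^(-ax) M(x) → 0` for every `a > 0`. If
`L ∈ Ẽ_k` and `F_L(α)` converges absolutely and vanishes on some half-plane `Re z > k' ≥ k`,
then `α(n) = 0` (on `Re z > k`) for every `n ≥ 1`. -/
theorem statement_14 (k : ℝ) (α : ℕ → ℂ → ℂ)
    (hol : ∀ n : ℕ, 1 ≤ n → MemOk k (α n))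
    (hI : ∀ n : ℕ, 1 ≤ n → MemIk k (α n) → ∀ z ∈ HalfPlane k, α n z = 0)
    (M : ℂ → ℝ) (hMcont : ContinuousOn M (HalfPlane k))
    (hMnonneg : ∀ z ∈ HalfPlane k, 0 ≤ M z)
    (hbound : ∀ n : ℕ, 1 ≤ n → ∀ z ∈ HalfPlane k, ‖α n z‖ ≤ M z * (n : ℝ) ^ k)
    (hM : ∀ a : ℝ, 0 < a →
      Tendsto (fun x : ℝ => Real.exp (-a * x) * M (x : ℂ)) atTop (nhds 0))
    (L : ℕ → ℂ → ℂ) (hL : MemEtk k L)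
    (k' : ℝ) (hk' : k ≤ k')
    (hsum : ∀ z : ℂ, k' < z.re → Summable (fun n : ℕ => ‖α (n + 1) z * L (n + 1) z‖))
    (hzero : ∀ z : ℂ, k' < z.re → (∑' n : ℕ, α (n + 1) z * L (n + 1) z) = 0) :
    ∀ n : ℕ, 1 ≤ n → ∀ z ∈ HalfPlane k, α n z = 0 := by
  intro n
  induction n using Nat.strong_induction_on with
  | _ m ih =>
  intro hm
  obtain ⟨-, hne, hratio⟩ := hL
  obtain ⟨C, hC, hLC⟩ := hratio m hm
  have hS : Summable fun n : ℕ => ((n + 1 : ℕ) : ℝ) ^ (-2 : ℝ) :=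
    (summable_nat_add_iff 1).2 (Real.summable_nat_rpow.2 (by norm_num))
  set S : ℝ := ∑' n : ℕ, ((n + 1 : ℕ) : ℝ) ^ (-2 : ℝ)
  have key : ∀ᶠ x : ℝ in atTop,
      ‖α m x‖ ≤ M x * (2 : ℝ) ^ (k - C * x + 2) * S := by
    filter_upwards [eventually_gt_atTop k', eventually_ge_atTop ((k + 2) / C)] with x hx hxC
    have hs : k - C * x + 2 ≤ 0 := by
      have := (div_le_iff₀ hC).1 hxC
      linarith
    have hxk : (x : ℂ) ∈ HalfPlane k := by
      simpa [HalfPlane] using hk'.trans_lt hx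
    have hLpos : 0 < ‖L m x‖ := norm_pos_iff.2 (hne m hm x hxk)
    have hMx := hMnonneg x hxk
    have hK : 0 ≤ M x * (2 : ℝ) ^ (k - C * x + 2) := by positivity
    have hx' : k' < (x : ℂ).re := by simpa using hx
    have h := norm_le_tsum_of_tsum_eq_zero (hsum x hx').of_norm (hzero x hx')
      (hS.mul_left (M x * (2 : ℝ) ^ (k - C * x + 2) * ‖L m x‖))
      (fun n => by positivity) (m - 1) ?_
    · rw [Nat.sub_add_cancel hm, norm_mul, tsum_mul_left] at h
      refine le_of_mul_le_mul_right (h.trans_eq ?_) hLpos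
      ring
    · intro n hn
      rcases lt_or_gt_of_ne (show n + 1 ≠ m by omega) with hlt | hgt
      · rw [ih (n + 1) hlt (by omega) x hxk, zero_mul, norm_zero]
        positivity
      · have hn2 : (2 : ℝ) ≤ ((n + 1 : ℕ) : ℝ) := by exact_mod_cast (by omega : 2 ≤ n + 1)
        have hpos : (0 : ℝ) < ((n + 1 : ℕ) : ℝ) := by linarith
        have hL' := (div_le_iff₀ hLpos).1 (hLC (n + 1) hgt x hxk)
        rw [ofReal_re] at hL'
        calc ‖α (n + 1) x * L (n + 1) x‖
            ≤ (M x * ((n + 1 : ℕ) : ℝ) ^ k) *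
                (((n + 1 : ℕ) : ℝ) ^ (-(C * x)) * ‖L m x‖) := by
              rw [norm_mul]
              gcongr
              exact hbound (n + 1) (by omega) x hxk
          _ = M x * ‖L m x‖ * ((n + 1 : ℕ) : ℝ) ^ (k - C * x) := by
              rw [sub_eq_add_neg, Real.rpow_add hpos]; ring
          _ ≤ M x * ‖L m x‖ *
                ((2 : ℝ) ^ (k - C * x + 2) * ((n + 1 : ℕ) : ℝ) ^ (-2 : ℝ)) := by
              gcongr
              exact rpow_le_two_rpow_mul_rpow_neg_two hn2 hs
          _ = _ := by ring
  have hlog : 0 < Real.log 2 := Real.log_pos (by norm_num)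
  have ha : 0 < C * Real.log 2 / 2 := by positivity
  refine hI m hm ⟨hol m hm, C * Real.log 2 / 2, ha, ?_⟩
  have hlim := (hM _ ha).mul_const ((2 : ℝ) ^ (k + 2) * S)
  rw [zero_mul] at hlim
  refine squeeze_zero' (Eventually.of_forall fun x => by positivity) ?_ hlim
  filter_upwards [key] with x hx
  refine (mul_le_mul_of_nonneg_left hx (Real.exp_pos _).le).trans_eq ?_
  have hexp : (2 : ℝ) ^ (k - C * x + 2) = (2 : ℝ) ^ (k + 2) * Real.exp (-(C * Real.log 2 * x)) := by
    rw [Real.rpow_def_of_pos two_pos, Real.rpow_def_of_pos two_pos, ← Real.exp_add]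
    ring_nf
  have hsplit : Real.exp (C * Real.log 2 / 2 * x) * Real.exp (-(C * Real.log 2 * x)) =
      Real.exp (-(C * Real.log 2 / 2) * x) := by
    rw [← Real.exp_add]
    ring_nf
  rw [hexp, ← hsplit]
  ring
end
end

section
/- Let k ∈ ℝ, let A_k be a ℂ-subalgebra of B_k with A_k ⊆ (B_k \ I_k) ∪ {0}, and let L ∈ Ẽ_k. Let α, β ∈ H_k and suppose there exists k' ≥ k such that both series F_L(α)(z) = ∑_{n=1}^∞ α(n)(z) L(n)(z) and F_L(β)(z) = ∑_{n=1}^∞ β(n)(z) L(n)(z) converge absolutely for Re z > k' and F_L(α)(z) = F_L(β)(z) for all Re z > k'. Then α(n) = β(n) for every n ≥ 1. -/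
open Complex Filter Topology

noncomputable section

/-- Membership in `H_k` (relative to a subalgebra `A` of `B_k`): a sequence with values in `A`
admitting a continuous `M : {Re z > k} → [0,∞)` with (i) `|α(n)(z)| ≤ M(z) n^k` for `n ≥ 1`,
`Re z > k`, and (ii) `e^(-ax) M(x) → 0` as `x → +∞` for every `a > 0`. -/
def MemHk (k : ℝ) (A : (ℂ → ℂ) → Prop) (α : ℕ → ℂ → ℂ) : Prop :=
  (∀ n : ℕ, 1 ≤ n → A (α n)) ∧
  ∃ M : ℂ → ℝ, ContinuousOn M (HalfPlane k) ∧ (∀ z ∈ HalfPlane k, 0 ≤ M z) ∧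
    (∀ n : ℕ, 1 ≤ n → ∀ z ∈ HalfPlane k, ‖α n z‖ ≤ M z * (n : ℝ) ^ k) ∧
    ∀ a : ℝ, 0 < a →
      Tendsto (fun x : ℝ => Real.exp (-a * x) * M (x : ℂ)) atTop (nhds 0)

/-- For `N ≥ 2` and `c / 2 ≥ k + 2`, the power `N ^ (k - c)` is at most `N⁻²` times
`2 ^ (-c / 2)`. -/
lemma rpow_mul_rpow_neg_le {k c N : ℝ} (hN : 2 ≤ N) (hc : 0 ≤ c) (hkc : k + 2 ≤ c / 2) :
    N ^ k * N ^ (-c) ≤ (N ^ 2)⁻¹ * Real.exp (-(c / 2 * Real.log 2)) := by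
  have hN0 : 0 < N := by linarith
  have h1 : N ^ (k - c / 2) ≤ (N ^ 2)⁻¹ := by
    calc N ^ (k - c / 2) ≤ N ^ (-2 : ℝ) :=
          Real.rpow_le_rpow_of_exponent_le (by linarith) (by linarith)
      _ = (N ^ 2)⁻¹ := by
          rw [Real.rpow_neg hN0.le]; norm_cast
  have h2 : N ^ (-(c / 2)) ≤ Real.exp (-(c / 2 * Real.log 2)) := by
    rw [Real.rpow_def_of_pos hN0, Real.exp_le_exp]
    have := Real.log_le_log (by norm_num) hN
    nlinarith
  calc N ^ k * N ^ (-c) = N ^ (k - c / 2) * N ^ (-(c / 2)) := by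
        rw [← Real.rpow_add hN0, ← Real.rpow_add hN0]; ring_nf
    _ ≤ _ := by gcongr

/-- If a sequence `g` of polynomial growth has vanishing generalized Dirichlet series at a real
point `x`, and all its terms before index `m` vanish, then `g m` is small at `x`. -/
lemma norm_le_of_tsum_eq_zero {g l : ℕ → ℂ} {k c M : ℝ} {m : ℕ} (hm : 1 ≤ m) (hM : 0 ≤ M)
    (hc : 0 ≤ c) (hkc : k + 2 ≤ c / 2) (hlm : l m ≠ 0)
    (hg : ∀ n, 1 ≤ n → ‖g n‖ ≤ M * (n : ℝ) ^ k)
    (hl : ∀ n, m + 1 ≤ n → ‖l n‖ / ‖l m‖ ≤ (n : ℝ) ^ (-c))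
    (hzero : ∀ n, 1 ≤ n → n < m → g n = 0)
    (hsum : Summable fun n : ℕ => g (n + 1) * l (n + 1))
    (htsum : ∑' n : ℕ, g (n + 1) * l (n + 1) = 0) :
    ‖g m‖ ≤ (∑' n : ℕ, (((n + 1 : ℕ) : ℝ) ^ 2)⁻¹) * M *
      Real.exp (-(c / 2 * Real.log 2)) := by
  have hlm' : 0 < ‖l m‖ := norm_pos_iff.mpr hlm
  have hS : Summable fun n : ℕ => (((n + 1 : ℕ) : ℝ) ^ 2)⁻¹ :=
    (summable_nat_add_iff (f := fun n : ℕ => ((n : ℝ) ^ 2)⁻¹) 1).mpr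
      (Real.summable_nat_pow_inv.mpr (by norm_num))
  set K := M * Real.exp (-(c / 2 * Real.log 2)) * ‖l m‖ with hK
  have hK0 : 0 ≤ K := by positivity
  have hsplit := hsum.tsum_eq_add_tsum_ite (m - 1)
  rw [htsum, Nat.sub_add_cancel hm] at hsplit
  have hbound := tsum_of_norm_bounded (hS.hasSum.mul_right K)
    (f := fun n : ℕ => if n = m - 1 then 0 else g (n + 1) * l (n + 1)) (fun n => by
      by_cases hn : n = m - 1
      · simp only [hn, if_true, norm_zero]; positivity
      simp only [hn, if_false]
      by_cases hnm : n + 1 < m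
      · simp only [hzero (n + 1) (by omega) hnm, zero_mul, norm_zero]; positivity
      have hn2 : m + 1 ≤ n + 1 := by omega
      have hN : (2 : ℝ) ≤ ((n + 1 : ℕ) : ℝ) := by exact_mod_cast (by omega : 2 ≤ n + 1)
      have h1 := hg (n + 1) (by omega)
      have h2 := (div_le_iff₀ hlm').mp (hl (n + 1) hn2)
      have h3 := rpow_mul_rpow_neg_le hN hc hkc
      rw [norm_mul]
      calc ‖g (n + 1)‖ * ‖l (n + 1)‖
          ≤ (M * ((n + 1 : ℕ) : ℝ) ^ k) * (((n + 1 : ℕ) : ℝ) ^ (-c) * ‖l m‖) := by gcongr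
        _ = M * ‖l m‖ * (((n + 1 : ℕ) : ℝ) ^ k * ((n + 1 : ℕ) : ℝ) ^ (-c)) := by ring
        _ ≤ M * ‖l m‖ * ((((n + 1 : ℕ) : ℝ) ^ 2)⁻¹ * Real.exp (-(c / 2 * Real.log 2))) := by
            gcongr
        _ = (((n + 1 : ℕ) : ℝ) ^ 2)⁻¹ * K := by rw [hK]; ring)
  have hgl : ‖g m * l m‖ = ‖∑' n : ℕ, if n = m - 1 then 0 else g (n + 1) * l (n + 1)‖ := by
    rw [eq_neg_of_add_eq_zero_left hsplit.symm, norm_neg]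
  rw [← hgl, norm_mul, hK] at hbound
  refine le_of_mul_le_mul_right (hbound.trans_eq ?_) hlm'
  ring

/-- let `A ⊆ (B_k \ I_k) ∪ {0}` be a `ℂ`-subalgebra of `B_k`, `L ∈ Ẽ_k`, and
`α, β ∈ H_k`. If `F_L(α)` and `F_L(β)` converge absolutely and coincide on some half-plane
`Re z > k' ≥ k`, then `α(n) = β(n)` (on `Re z > k`) for all `n ≥ 1`. -/
theorem statement_15 (k : ℝ)
    (A : (ℂ → ℂ) → Prop)
    (hAB : ∀ f, A f → MemBk k f)
    (hAI : ∀ f, A f → MemIk k f → ∀ z ∈ HalfPlane k, f z = 0)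
    (hAadd : ∀ f g, A f → A g → A (fun z => f z + g z))
    (hAmul : ∀ f g, A f → A g → A (fun z => f z * g z))
    (hAsmul : ∀ (c : ℂ) (f), A f → A (fun z => c * f z))
    (hAone : A (fun _ => (1 : ℂ)))
    (L : ℕ → ℂ → ℂ) (hL : MemEtk k L)
    (α β : ℕ → ℂ → ℂ) (hα : MemHk k A α) (hβ : MemHk k A β)
    (k' : ℝ) (hk' : k ≤ k')
    (hsumα : ∀ z : ℂ, k' < z.re → Summable (fun n : ℕ => ‖α (n + 1) z * L (n + 1) z‖))
    (hsumβ : ∀ z : ℂ, k' < z.re → Summable (fun n : ℕ => ‖β (n + 1) z * L (n + 1) z‖))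
    (heq : ∀ z : ℂ, k' < z.re →
      (∑' n : ℕ, α (n + 1) z * L (n + 1) z) = ∑' n : ℕ, β (n + 1) z * L (n + 1) z) :
    ∀ n : ℕ, 1 ≤ n → ∀ z ∈ HalfPlane k, α n z = β n z := by
  obtain ⟨-, hL0, hLC⟩ := hL
  obtain ⟨hαA, Mα, -, hMα0, hMα, hMαt⟩ := hα
  obtain ⟨hβA, Mβ, -, hMβ0, hMβ, hMβt⟩ := hβ
  intro m
  induction m using Nat.strong_induction_on with
  | _ m ih =>
  intro hm
  have hγA : A (fun z => α m z + (-1) * β m z) :=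
    hAadd _ _ (hαA m hm) (hAsmul (-1) _ (hβA m hm))
  suffices hI : MemIk k (fun z => α m z + (-1) * β m z) by
    intro z hz
    linear_combination hAI _ hγA hI z hz
  obtain ⟨C, hC, hLC⟩ := hLC m hm
  have hlog : 0 < Real.log 2 := Real.log_pos (by norm_num)
  set a := C * Real.log 2 / 4 with ha
  have ha0 : 0 < a := by positivity
  refine ⟨(hAB _ hγA).1, a, ha0, ?_⟩
  set S := ∑' n : ℕ, (((n + 1 : ℕ) : ℝ) ^ 2)⁻¹
  have hlim : Tendsto (fun x : ℝ => S * (Real.exp (-a * x) * Mα x + Real.exp (-a * x) * Mβ x))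
      atTop (𝓝 0) := by
    simpa using ((hMαt a ha0).add (hMβt a ha0)).const_mul S
  refine squeeze_zero' (Eventually.of_forall fun x => by positivity) ?_ hlim
  filter_upwards [eventually_gt_atTop k', eventually_ge_atTop 0,
    eventually_ge_atTop (2 * (k + 2) / C)] with x hxk' hx0 hxC
  have hx : (x : ℂ) ∈ HalfPlane k := by
    simp only [HalfPlane, Set.mem_ofPred_eq, ofReal_re]; linarith
  have hxk'' : k' < (x : ℂ).re := by simpa using hxk'
  have hα' := (hsumα x hxk'').of_norm
  have hβ' := (hsumβ x hxk'').of_norm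
  have hfun : (fun n : ℕ => (α (n + 1) x + (-1) * β (n + 1) x) * L (n + 1) x) =
      fun n : ℕ => α (n + 1) x * L (n + 1) x - β (n + 1) x * L (n + 1) x := by
    funext n; ring
  have key := norm_le_of_tsum_eq_zero (g := fun n => α n x + (-1) * β n x)
    (l := fun n => L n x) (k := k) (c := C * x) (M := Mα x + Mβ x) hm
    (add_nonneg (hMα0 _ hx) (hMβ0 _ hx)) (by positivity)
    (by rw [div_le_iff₀ hC] at hxC; linarith) (hL0 m hm _ hx)
    (fun n hn => by
      refine (norm_add_le _ _).trans ?_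
      have h1 := hMα n hn _ hx
      have h2 := hMβ n hn _ hx
      simp only [neg_mul, one_mul, norm_neg]
      linarith)
    (fun n hn => by simpa using hLC n hn _ hx)
    (fun n hn hnm => by simp [ih n hnm hn _ hx])
    (by rw [hfun]; exact hα'.sub hβ')
    (by rw [hfun, hα'.tsum_sub hβ', heq x hxk'', sub_self])
  calc _ ≤ Real.exp (a * x) *
        (S * (Mα x + Mβ x) * Real.exp (-(C * x / 2 * Real.log 2))) := by gcongr
    _ = S * (Mα x + Mβ x) * (Real.exp (a * x) * Real.exp (-(C * x / 2 * Real.log 2))) := by ring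
    _ = S * (Mα x + Mβ x) * Real.exp (-a * x) := by
        rw [← Real.exp_add]; congr 2; rw [ha]; ring
    _ = _ := by ring
end
end

section
/- Let k ∈ ℝ, let A_k be a ℂ-subalgebra of B_k with A_k ⊆ (B_k \ I_k) ∪ {0}, let L ∈ Ẽ_k, and let α_1, …, α_r ∈ H_k. Assume there exists a subset S of {Re z > k} having an accumulation point in {Re z > k} such that for every z ∈ S the complex sequences n ↦ α_1(n)(z), …, n ↦ α_r(n)(z) are linearly independent over ℂ. Let k' ≥ k be such that all series F_L(α_j)(z) = ∑_{n=1}^∞ α_j(n)(z) L(n)(z) converge absolutely for Re z > k'. If g_1, …, g_r ∈ A_k satisfy g_1(z) F_L(α_1)(z) + ⋯ + g_r(z) F_L(α_r)(z) = 0 for all Re z > k', then g_1 = ⋯ = g_r = 0. In particular, F_L(α_1), …, F_L(α_r) are linearly independent over the quotient field of A_k. -/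
open Complex Filter Topology

noncomputable section

theorem algebra_sum_mem {ι : Type*} (A : (ℂ → ℂ) → Prop)
    (hAadd : ∀ f g, A f → A g → A (fun z => f z + g z))
    (hAzero : A (fun _ => 0)) (s : Finset ι) (f : ι → ℂ → ℂ) (hf : ∀ i, A (f i)) :
    A (fun z => ∑ i ∈ s, f i z) := by
  classical
  induction s using Finset.induction_on with
  | empty => simpa using hAzero
  | insert i s hi ih =>
    simp only [Finset.sum_insert hi]
    exact hAadd _ _ (hf i) ih

/-- A sum of products of functions of subexponential growth has subexponential growth. -/
theorem tendsto_exp_neg_mul_sum {ι : Type*} [Fintype ι] (u v : ι → ℝ → ℝ)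
    (hu : ∀ i, ∀ a : ℝ, 0 < a → Tendsto (fun x => Real.exp (-a * x) * u i x) atTop (𝓝 0))
    (hv : ∀ i, ∀ a : ℝ, 0 < a → Tendsto (fun x => Real.exp (-a * x) * v i x) atTop (𝓝 0))
    (a : ℝ) (ha : 0 < a) :
    Tendsto (fun x => Real.exp (-a * x) * ∑ i, u i x * v i x) atTop (𝓝 0) := by
  have h : Tendsto (fun x => ∑ i, (Real.exp (-(a / 2) * x) * u i x) *
      (Real.exp (-(a / 2) * x) * v i x)) atTop (𝓝 (∑ _i : ι, (0 : ℝ) * 0)) :=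
    tendsto_finsetSum _ fun i _ => (hu i _ (half_pos ha)).mul (hv i _ (half_pos ha))
  simp only [mul_zero, Finset.sum_const_zero] at h
  refine h.congr fun x => ?_
  rw [Finset.mul_sum]
  refine Finset.sum_congr rfl fun i _ => ?_
  have : Real.exp (-a * x) = Real.exp (-(a / 2) * x) * Real.exp (-(a / 2) * x) := by
    rw [← Real.exp_add]; ring_nf
  rw [this]; ring

theorem rpow_le_exp_mul_rpow_neg_two {n t : ℝ} (hn : 2 ≤ n) (ht : t + 2 ≤ 0) :
    n ^ t ≤ Real.exp (Real.log 2 * (t + 2)) * n ^ (-2 : ℝ) := by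
  have hn0 : 0 < n := by linarith
  have h : n ^ t = n ^ (t + 2) * n ^ (-2 : ℝ) := by
    rw [← Real.rpow_add hn0]; ring_nf
  rw [h, ← Real.rpow_def_of_pos two_pos]
  gcongr ?_ * _
  exact Real.rpow_le_rpow_of_nonpos two_pos hn ht

/-- If a series `∑ β(n) L(n)` vanishes at `x` and its terms before the index `N` vanish, then the
coefficient at `N` is bounded by the tail, hence decays exponentially up to the factor `G`. -/
theorem norm_leading_coeff_le {β ℓ : ℕ → ℂ} {N : ℕ} {G k t : ℝ}
    (hsum : Summable fun n => β (n + 1) * ℓ (n + 1))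
    (hzero : ∑' n, β (n + 1) * ℓ (n + 1) = 0)
    (hlt : ∀ n < N, β (n + 1) = 0)
    (hβ : ∀ n, 1 ≤ n → ‖β n‖ ≤ G * (n : ℝ) ^ k)
    (hℓ0 : ℓ (N + 1) ≠ 0)
    (hℓ : ∀ n, N + 1 + 1 ≤ n → ‖ℓ n‖ / ‖ℓ (N + 1)‖ ≤ (n : ℝ) ^ (-t))
    (hG : 0 ≤ G) (ht : k - t + 2 ≤ 0) :
    ‖β (N + 1)‖ ≤ G * Real.exp (Real.log 2 * (k - t + 2)) *
      ∑' m : ℕ, ((m + (N + 1) + 1 : ℕ) : ℝ) ^ (-2 : ℝ) := by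
  have hsplit := hsum.sum_add_tsum_nat_add (N + 1)
  have hfirst : ∑ n ∈ Finset.range N, β (n + 1) * ℓ (n + 1) = 0 :=
    Finset.sum_eq_zero fun n hn => by rw [hlt n (Finset.mem_range.1 hn), zero_mul]
  rw [hzero, Finset.sum_range_succ, hfirst, zero_add] at hsplit
  have hs2 : Summable fun m : ℕ => ((m + (N + 1) + 1 : ℕ) : ℝ) ^ (-2 : ℝ) :=
    (summable_nat_add_iff (f := fun n : ℕ => (n : ℝ) ^ (-2 : ℝ)) (N + 1 + 1)).2
      (Real.summable_nat_rpow.2 (by norm_num))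
  have hpos : 0 < ‖ℓ (N + 1)‖ := norm_pos_iff.2 hℓ0
  have hbound := tsum_of_norm_bounded
    (hs2.hasSum.mul_left (‖ℓ (N + 1)‖ * (G * Real.exp (Real.log 2 * (k - t + 2)))))
    (f := fun m => β (m + (N + 1) + 1) * ℓ (m + (N + 1) + 1)) (fun m => by
      set n := m + (N + 1) + 1 with hn
      have hn2 : (2 : ℝ) ≤ (n : ℝ) := by exact_mod_cast (by omega : 2 ≤ n)
      have h1 := hβ n (by omega)
      have h2 := (div_le_iff₀ hpos).1 (hℓ n (by omega))
      have h3 := rpow_le_exp_mul_rpow_neg_two hn2 ht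
      rw [sub_eq_add_neg, Real.rpow_add (by linarith), ← sub_eq_add_neg] at h3
      rw [norm_mul]
      calc ‖β n‖ * ‖ℓ n‖ ≤ (G * (n : ℝ) ^ k) * ((n : ℝ) ^ (-t) * ‖ℓ (N + 1)‖) := by gcongr
        _ = ‖ℓ (N + 1)‖ * G * ((n : ℝ) ^ k * (n : ℝ) ^ (-t)) := by ring
        _ ≤ ‖ℓ (N + 1)‖ * G *
            (Real.exp (Real.log 2 * (k - t + 2)) * (n : ℝ) ^ (-2 : ℝ)) := by gcongr
        _ = _ := by ring)
  rw [← neg_eq_of_add_eq_zero_right hsplit, norm_neg, norm_mul] at hbound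
  refine le_of_mul_le_mul_right (hbound.trans_eq ?_) hpos
  ring

theorem eqOn_zero_of_accPt {k : ℝ} {f : ℂ → ℂ} (hf : MemOk k f) {S : Set ℂ} {z₀ : ℂ}
    (hz₀ : z₀ ∈ HalfPlane k) (hacc : AccPt z₀ (𝓟 S)) (hS : ∀ z ∈ S, f z = 0) :
    ∀ z ∈ HalfPlane k, f z = 0 := by
  have ho : IsOpen (HalfPlane k) := isOpen_lt continuous_const continuous_re
  have hc : IsPreconnected (HalfPlane k) := (convex_halfSpace_re_gt k).isPreconnected
  have hfreq : ∃ᶠ z in 𝓝[≠] z₀, f z = 0 :=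
    (accPt_iff_frequently_nhdsNE.1 hacc).mono hS
  exact (DifferentiableOn.analyticOnNhd hf ho).eqOn_zero_of_preconnected_of_frequently_eq_zero
    hc hz₀ hfreq

/-- let `A ⊆ (B_k \ I_k) ∪ {0}` be a `ℂ`-subalgebra of `B_k`, `L ∈ Ẽ_k`, and
`α_1, …, α_r ∈ H_k`. Suppose on a set `S ⊆ {Re z > k}` with an accumulation point in
`{Re z > k}` the complex sequences `n ↦ α_j(n)(z)` (`n ≥ 1`) are linearly independent over
`ℂ`. If `g_1, …, g_r ∈ A` satisfy `∑_j g_j(z) F_L(α_j)(z) = 0` on a half-plane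
`Re z > k' ≥ k` of absolute convergence, then all `g_j` vanish (on `Re z > k`); in
particular the `F_L(α_j)` are linearly independent over the quotient field of `A`. -/
theorem statement_16 (k : ℝ)
    (A : (ℂ → ℂ) → Prop)
    (hAB : ∀ f, A f → MemBk k f)
    (hAI : ∀ f, A f → MemIk k f → ∀ z ∈ HalfPlane k, f z = 0)
    (hAadd : ∀ f g, A f → A g → A (fun z => f z + g z))
    (hAmul : ∀ f g, A f → A g → A (fun z => f z * g z))
    (hAsmul : ∀ (c : ℂ) (f), A f → A (fun z => c * f z))
    (hAone : A (fun _ => (1 : ℂ)))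
    (L : ℕ → ℂ → ℂ) (hL : MemEtk k L)
    (r : ℕ) (α : Fin r → ℕ → ℂ → ℂ) (hα : ∀ j, MemHk k A (α j))
    (S : Set ℂ) (hS : S ⊆ HalfPlane k)
    (hacc : ∃ z₀ ∈ HalfPlane k, AccPt z₀ (Filter.principal S))
    (hlin : ∀ z ∈ S, ∀ c : Fin r → ℂ,
      (∀ n : ℕ, 1 ≤ n → ∑ j, c j * α j n z = 0) → ∀ j, c j = 0)
    (k' : ℝ) (hk' : k ≤ k')
    (hsum : ∀ j, ∀ z : ℂ, k' < z.re →
      Summable (fun n : ℕ => ‖α j (n + 1) z * L (n + 1) z‖))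
    (g : Fin r → ℂ → ℂ) (hg : ∀ j, A (g j))
    (hrel : ∀ z : ℂ, k' < z.re →
      ∑ j, g j z * ∑' n : ℕ, α j (n + 1) z * L (n + 1) z = 0) :
    ∀ j, ∀ z ∈ HalfPlane k, g j z = 0 := by
  set β : ℕ → ℂ → ℂ := fun n z => ∑ j, g j z * α j n z with hβdef
  have hAzero : A (fun _ => 0) := by simpa using hAsmul 0 _ hAone
  have hβA : ∀ n, 1 ≤ n → A (β n) := fun n hn =>
    algebra_sum_mem A hAadd hAzero _ (fun j z => g j z * α j n z)
      fun j => hAmul _ _ (hg j) ((hα j).1 n hn)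
  obtain ⟨-, hL0, hLq⟩ := hL
  choose M _ hM0 hMα hMexp using fun j => (hα j).2
  set G : ℝ → ℝ := fun x => ∑ j, ‖g j (x : ℂ)‖ * M j (x : ℂ) with hGdef
  have hGexp : ∀ a : ℝ, 0 < a → Tendsto (fun x => Real.exp (-a * x) * G x) atTop (𝓝 0) :=
    tendsto_exp_neg_mul_sum (fun j x => ‖g j (x : ℂ)‖) (fun j x => M j (x : ℂ))
      (fun j => (hAB _ (hg j)).2) hMexp
  have hβG : ∀ x : ℝ, (x : ℂ) ∈ HalfPlane k → ∀ n, 1 ≤ n →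
      ‖β n x‖ ≤ G x * (n : ℝ) ^ k := fun x hx n hn => by
    rw [hGdef, Finset.sum_mul]
    refine norm_sum_le_of_le _ fun j _ => ?_
    rw [norm_mul, mul_assoc]
    exact mul_le_mul_of_nonneg_left (hMα j n hn _ hx) (norm_nonneg _)
  have hseries : ∀ z : ℂ, k' < z.re →
      HasSum (fun n : ℕ => β (n + 1) z * L (n + 1) z) 0 := fun z hz => by
    have h := hasSum_sum (s := Finset.univ)
      fun j _ => ((hsum j z hz).of_norm.hasSum.mul_left (g j z))
    rw [hrel z hz] at h
    refine h.congr_fun fun n => ?_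
    rw [hβdef, Finset.sum_mul]
    exact Finset.sum_congr rfl fun j _ => by ring
  have hβ0 : ∀ N : ℕ, ∀ z ∈ HalfPlane k, β (N + 1) z = 0 := by
    intro N
    induction N using Nat.strong_induction_on with
    | _ N ih =>
      obtain ⟨C, hC, hCL⟩ := hLq (N + 1) (by omega)
      have hlog : 0 < Real.log 2 := Real.log_pos one_lt_two
      refine hAI _ (hβA _ (by omega)) ⟨(hAB _ (hβA _ (by omega))).1, C * Real.log 2 / 2,
        by positivity, ?_⟩
      set K : ℝ := ∑' m : ℕ, ((m + (N + 1) + 1 : ℕ) : ℝ) ^ (-2 : ℝ)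
      have hlim := (hGexp (C * Real.log 2 / 2) (by positivity)).mul_const
        (Real.exp (Real.log 2 * (k + 2)) * K)
      rw [zero_mul] at hlim
      refine squeeze_zero' (Eventually.of_forall fun x => by positivity) ?_ hlim
      filter_upwards [eventually_gt_atTop k', eventually_ge_atTop ((k + 2) / C)] with x hx hxC
      have hxk : (x : ℂ) ∈ HalfPlane k := by
        simpa [HalfPlane] using hk'.trans_lt hx
      have hs := hseries x (by simpa using hx)
      have ht : k - C * x + 2 ≤ 0 := by
        have := (div_le_iff₀ hC).1 hxC
        linarith
      have hbd := norm_leading_coeff_le (β := fun n => β n x) (ℓ := fun n => L n x)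
        (G := G x) hs.summable hs.tsum_eq (fun n hn => ih n hn x hxk) (hβG x hxk)
        (hL0 _ (by omega) x hxk) (fun n hn => by simpa using hCL n hn x hxk)
        (Finset.sum_nonneg fun j _ => mul_nonneg (norm_nonneg _) (hM0 j _ hxk)) ht
      have hexp : Real.exp (C * Real.log 2 / 2 * x) * Real.exp (Real.log 2 * (k - C * x + 2)) =
          Real.exp (-(C * Real.log 2 / 2) * x) * Real.exp (Real.log 2 * (k + 2)) := by
        rw [← Real.exp_add, ← Real.exp_add]; ring_nf
      calc Real.exp (C * Real.log 2 / 2 * x) * ‖β (N + 1) x‖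
          ≤ Real.exp (C * Real.log 2 / 2 * x) *
            (G x * Real.exp (Real.log 2 * (k - C * x + 2)) * K) := by gcongr
        _ = (Real.exp (C * Real.log 2 / 2 * x) *
            Real.exp (Real.log 2 * (k - C * x + 2))) * (G x * K) := by ring
        _ = _ := by rw [hexp]; ring
  obtain ⟨z₀, hz₀, hacc⟩ := hacc
  refine fun j => eqOn_zero_of_accPt (hAB _ (hg j)).1 hz₀ hacc fun z hz =>
    hlin z hz (fun j => g j z) (fun n hn => ?_) j
  obtain ⟨m, rfl⟩ := Nat.exists_eq_add_of_le' hn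
  exact hβ0 m z (hS hz)
end
end

section
/- Let k ∈ ℝ, let A_k be a ℂ-subalgebra of B_k with A_k ⊆ (B_k \ I_k) ∪ {0}, and let L ∈ Ẽ_k satisfy L(ab) = L(a)L(b) for all positive integers a, b, with L not identically zero. Let α_1, …, α_r ∈ H_k and assume there exists a subset S of {Re z > k} having an accumulation point in {Re z > k} such that for every z ∈ S the complex sequences n ↦ α_1(n)(z), …, n ↦ α_r(n)(z) are algebraically independent over ℂ in the Dirichlet-convolution ring of complex sequences. Let k' ≥ k be such that all relevant series converge absolutely for Re z > k'. Then for every finite set I ⊆ ℕ^r and functions g_i ∈ A_k (i ∈ I), if ∑_{i=(i_1,…,i_r)∈I} g_i(z) F_L(α_1)(z)^{i_1} ⋯ F_L(α_r)(z)^{i_r} = 0 for all Re z > k', then g_i = 0 for all i ∈ I; that is, F_L(α_1), …, F_L(α_r) are algebraically independent over A_k (equivalently, over its quotient field). -/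
open Complex Filter Topology

noncomputable section

/-- The element of the Dirichlet-convolution ring of complex sequences attached to a sequence
defined on `n ≥ 1`. -/
def toArith (f : ℕ → ℂ) : ArithmeticFunction ℂ := ⟨fun n => if n = 0 then 0 else f n, by simp⟩

/-- The canonical embedding `ℂ → ArithmeticFunction ℂ` (i.e. `c ↦ c·e`), realizing the
`ℂ`-algebra structure of the Dirichlet-convolution ring. -/
def constArith (c : ℂ) : ArithmeticFunction ℂ := ⟨fun n => if n = 1 then c else 0, by simp⟩

/-- Algebraic independence over `ℂ` of a family of complex sequences inside the
Dirichlet-convolution ring `ArithmeticFunction ℂ`: no nontrivial polynomial relation with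
complex coefficients holds. -/
def DirichletAlgInd (r : ℕ) (a : Fin r → ℕ → ℂ) : Prop :=
  ∀ (I : Finset (Fin r → ℕ)) (c : (Fin r → ℕ) → ℂ),
    (∑ i ∈ I, constArith (c i) * ∏ j, toArith (a j) ^ (i j)) = 0 → ∀ i ∈ I, c i = 0

/-- The constant `c` as a multiple of the unit of the Dirichlet-convolution ring. -/
def arithConst {R : Type*} [CommRing R] (c : R) : ArithmeticFunction R :=
  ⟨fun n => if n = 1 then c else 0, by simp⟩

/-- Apply a ring homomorphism to the values of an arithmetic function and multiply pointwise by
a completely multiplicative function. -/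
def arithTwist {R S : Type*} [CommRing R] [CommRing S] (φ : R →+* S) (l : ℕ →* S) :
    ArithmeticFunction R →+* ArithmeticFunction S where
  toFun f := ⟨fun n => φ (f n) * l n, by simp⟩
  map_one' := by
    ext n
    by_cases hn : n = 1 <;> simp [hn, ArithmeticFunction.one_apply]
  map_zero' := by ext n; simp
  map_add' f g := by
    ext n
    simp only [ArithmeticFunction.coe_mk, ArithmeticFunction.add_apply, map_add, add_mul]
    rfl
  map_mul' f g := by
    ext n
    simp only [ArithmeticFunction.coe_mk, ArithmeticFunction.mul_apply, map_sum, map_mul,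
      Finset.sum_mul]
    refine Finset.sum_congr rfl fun p hp => ?_
    rw [← (Nat.mem_divisorsAntidiagonal.1 hp).1, map_mul]
    exact mul_mul_mul_comm _ _ _ _

@[simp]
lemma arithTwist_apply {R S : Type*} [CommRing R] [CommRing S] (φ : R →+* S) (l : ℕ →* S)
    (f : ArithmeticFunction R) (n : ℕ) : arithTwist φ l f n = φ (f n) * l n := rfl

lemma arithTwist_arithConst {S : Type*} [CommRing S] {R : Type*} [CommRing R] (φ : R →+* S)
    (l : ℕ →* S) (c : R) : arithTwist φ l (arithConst c) = arithConst (φ c) := by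
  ext n
  rw [arithTwist_apply]
  by_cases hn : n = 1 <;> simp [arithConst, hn]

lemma lseriesHasSum_zero_iff (f : ArithmeticFunction ℂ) (v : ℂ) :
    LSeriesHasSum f 0 v ↔ HasSum f v := by
  unfold LSeriesHasSum
  suffices h : LSeries.term f 0 = f by rw [h]
  ext n
  by_cases hn : n = 0 <;> simp [LSeries.term, hn]

/-- The pairs `(f, v)` of a summable arithmetic function and its sum. -/
def sumGraph : Subsemiring (ArithmeticFunction ℂ × ℂ) where
  carrier := {p | HasSum p.1 p.2}
  zero_mem' := hasSum_zero
  add_mem' hp hq := HasSum.add hp hq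
  one_mem' := by
    have := hasSum_single (f := (1 : ArithmeticFunction ℂ)) 1 fun n hn => by
      simp [hn]
    simpa using this
  mul_mem' {p q} hp hq := by
    have h := ArithmeticFunction.LSeriesHasSum_mul ((lseriesHasSum_zero_iff _ _).2 hp)
      ((lseriesHasSum_zero_iff _ _).2 hq)
    exact (lseriesHasSum_zero_iff _ _).1 h

lemma hasSum_arithConst (c : ℂ) : HasSum (arithConst c) c := by
  have := hasSum_single (f := arithConst c) 1 fun n hn => by simp [arithConst, hn]
  simpa [arithConst] using this

lemma hasSum_dirichlet_polynomial {r : ℕ} (I : Finset (Fin r → ℕ)) (c : (Fin r → ℕ) → ℂ)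
    (a : Fin r → ArithmeticFunction ℂ) (v : Fin r → ℂ) (h : ∀ j, HasSum (a j) (v j)) :
    HasSum (∑ i ∈ I, arithConst (c i) * ∏ j, a j ^ i j : ArithmeticFunction ℂ)
      (∑ i ∈ I, c i * ∏ j, v j ^ i j) := by
  have key : ∑ i ∈ I, ((arithConst (c i), c i) * ∏ j, (a j, v j) ^ i j) ∈ sumGraph :=
    sum_mem fun i _ => mul_mem (hasSum_arithConst (c i))
      (prod_mem fun j _ => pow_mem (h j) (i j))
  have key' : HasSum _ _ := key
  simpa [Prod.fst_sum, Prod.snd_sum, Prod.fst_prod, Prod.snd_prod] using key'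

/-- A real function that is negligible against every increasing exponential at `+∞`. -/
def SubExp (m : ℝ → ℝ) : Prop :=
  ∀ a : ℝ, 0 < a → Tendsto (fun x => Real.exp (-a * x) * m x) atTop (nhds 0)

lemma SubExp.add {m m' : ℝ → ℝ} (h : SubExp m) (h' : SubExp m') :
    SubExp fun x => m x + m' x := fun a ha => by
  simpa [mul_add] using (h a ha).add (h' a ha)

lemma SubExp.mul {m m' : ℝ → ℝ} (h : SubExp m) (h' : SubExp m') :
    SubExp fun x => m x * m' x := fun a ha => by
  have := (h (a / 2) (by positivity)).mul (h' (a / 2) (by positivity))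
  rw [mul_zero] at this
  refine this.congr fun x => ?_
  rw [show -a * x = -(a / 2) * x + -(a / 2) * x by ring, Real.exp_add]
  ring

/-- Polynomial growth in `n`, with a constant that is subexponential along the real axis. -/
def PolyGrowth (k : ℝ) (f : ArithmeticFunction (ℂ → ℂ)) : Prop :=
  ∃ (K : ℕ) (m : ℝ → ℝ), SubExp m ∧ ∀ x : ℝ, k < x → 0 ≤ m x ∧
    ∀ n : ℕ, ‖f n (x : ℂ)‖ ≤ m x * (n : ℝ) ^ K

lemma PolyGrowth.add {k : ℝ} {f g : ArithmeticFunction (ℂ → ℂ)} (hf : PolyGrowth k f)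
    (hg : PolyGrowth k g) : PolyGrowth k (f + g) := by
  obtain ⟨K, m, hm, h⟩ := hf
  obtain ⟨K', m', hm', h'⟩ := hg
  refine ⟨K + K', _, hm.add hm', fun x hx => ⟨add_nonneg (h x hx).1 (h' x hx).1, fun n => ?_⟩⟩
  obtain rfl | hn := Nat.eq_zero_or_pos n
  · simpa using mul_nonneg (add_nonneg (h x hx).1 (h' x hx).1) (by positivity)
  have hn1 : (1 : ℝ) ≤ n := by exact_mod_cast hn
  have h1 := (h x hx).1
  have h1' := (h' x hx).1
  calc ‖(f + g) n (x : ℂ)‖ ≤ ‖f n (x : ℂ)‖ + ‖g n (x : ℂ)‖ := by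
        simpa using norm_add_le (f n (x : ℂ)) (g n (x : ℂ))
    _ ≤ m x * (n : ℝ) ^ K + m' x * (n : ℝ) ^ K' := add_le_add ((h x hx).2 n) ((h' x hx).2 n)
    _ ≤ m x * (n : ℝ) ^ (K + K') + m' x * (n : ℝ) ^ (K + K') := by
        gcongr <;> first | assumption | omega
    _ = _ := by ring

lemma PolyGrowth.mul {k : ℝ} {f g : ArithmeticFunction (ℂ → ℂ)} (hf : PolyGrowth k f)
    (hg : PolyGrowth k g) : PolyGrowth k (f * g) := by
  obtain ⟨K, m, hm, h⟩ := hf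
  obtain ⟨K', m', hm', h'⟩ := hg
  refine ⟨K + K' + 1, _, hm.mul hm',
    fun x hx => ⟨mul_nonneg (h x hx).1 (h' x hx).1, fun n => ?_⟩⟩
  have h1 := (h x hx).1
  have h1' := (h' x hx).1
  rw [ArithmeticFunction.mul_apply, Finset.sum_apply]
  calc ‖∑ p ∈ n.divisorsAntidiagonal, (f p.1 * g p.2) (x : ℂ)‖
      ≤ ∑ p ∈ n.divisorsAntidiagonal, m x * m' x * (n : ℝ) ^ (K + K') := by
        refine norm_sum_le_of_le _ fun p hp => ?_
        obtain ⟨hpn, hn⟩ := Nat.mem_divisorsAntidiagonal.1 hp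
        have h2 : (p.1 : ℝ) ≤ n := by
          exact_mod_cast Nat.le_of_dvd (Nat.pos_of_ne_zero hn) ⟨p.2, hpn.symm⟩
        have h3 : (p.2 : ℝ) ≤ n := by
          exact_mod_cast Nat.le_of_dvd (Nat.pos_of_ne_zero hn) ⟨p.1, by rw [← hpn, mul_comm]⟩
        calc ‖(f p.1 * g p.2) (x : ℂ)‖ = ‖f p.1 (x : ℂ)‖ * ‖g p.2 (x : ℂ)‖ := by simp
          _ ≤ (m x * (p.1 : ℝ) ^ K) * (m' x * (p.2 : ℝ) ^ K') :=
            mul_le_mul ((h x hx).2 _) ((h' x hx).2 _) (norm_nonneg _) (by positivity)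
          _ ≤ (m x * (n : ℝ) ^ K) * (m' x * (n : ℝ) ^ K') := by gcongr
          _ = _ := by ring
    _ = n.divisorsAntidiagonal.card * (m x * m' x * (n : ℝ) ^ (K + K')) := by simp
    _ ≤ n * (m x * m' x * (n : ℝ) ^ (K + K')) := by
        gcongr
        rw [← Nat.map_div_right_divisors, Finset.card_map]
        exact Nat.card_divisors_le_self n
    _ = _ := by ring

lemma PolyGrowth.arithConst {k : ℝ} {f : ℂ → ℂ} (hf : SubExp fun x => ‖f (x : ℂ)‖) :
    PolyGrowth k (arithConst f) := by
  refine ⟨0, _, hf, fun x _ => ⟨norm_nonneg _, fun n => ?_⟩⟩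
  by_cases hn : n = 1 <;> simp [_root_.arithConst, hn]

/-- Arithmetic functions of polynomial growth with values in a given algebra of functions. -/
def growthSubsemiring (k : ℝ) (A : Subalgebra ℂ (ℂ → ℂ))
    (hA : ∀ f ∈ A, SubExp fun x => ‖f (x : ℂ)‖) :
    Subsemiring (ArithmeticFunction (ℂ → ℂ)) where
  carrier := {f | (∀ n, f n ∈ A) ∧ PolyGrowth k f}
  zero_mem' := by
    refine ⟨fun n => by simp, 0, fun _ => 0, fun a _ => by simp, fun x _ => by simp⟩
  one_mem' := by
    have : arithConst (1 : ℂ → ℂ) = 1 := by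
      ext n : 1
      simp [arithConst, ArithmeticFunction.one_apply]
    refine ⟨fun n => ?_, this ▸ PolyGrowth.arithConst (hA 1 A.one_mem)⟩
    rw [ArithmeticFunction.one_apply]
    split_ifs
    exacts [A.one_mem, A.zero_mem]
  add_mem' hf hg := ⟨fun n => add_mem (hf.1 n) (hg.1 n), hf.2.add hg.2⟩
  mul_mem' {f g} hf hg := by
    refine ⟨fun n => ?_, hf.2.mul hg.2⟩
    rw [ArithmeticFunction.mul_apply]
    exact sum_mem fun p _ => mul_mem (hf.1 _) (hg.1 _)

/-- The first nonzero coefficient of a vanishing series decays exponentially. -/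
lemma tendsto_exp_mul_leading_coeff {k k' : ℝ} (hk' : k ≤ k') {L : ℕ → ℂ → ℂ}
    {f : ArithmeticFunction (ℂ → ℂ)} (hf : PolyGrowth k f) {n₀ : ℕ}
    (hL : ∀ z ∈ HalfPlane k, L n₀ z ≠ 0) {C : ℝ} (hC : 0 < C)
    (hLC : ∀ n : ℕ, n₀ + 1 ≤ n → ∀ z ∈ HalfPlane k,
      ‖L n z‖ / ‖L n₀ z‖ ≤ (n : ℝ) ^ (-(C * z.re)))
    (hlt : ∀ n < n₀, ∀ z ∈ HalfPlane k, f n z = 0) (hn₀ : 1 ≤ n₀)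
    (hsum : ∀ x : ℝ, k' < x → HasSum (fun n => f n (x : ℂ) * L n (x : ℂ)) 0) :
    ∃ a : ℝ, 0 < a ∧
      Tendsto (fun x : ℝ => Real.exp (a * x) * ‖f n₀ (x : ℂ)‖) atTop (nhds 0) := by
  obtain ⟨K, m, hm, h⟩ := hf
  have hlog : 0 < Real.log 2 := Real.log_pos (by norm_num)
  set Z : ℝ := ∑' n : ℕ, ((n : ℝ) ^ 2)⁻¹
  have hZs : Summable fun n : ℕ => ((n : ℝ) ^ 2)⁻¹ :=
    Real.summable_nat_pow_inv.2 (by norm_num)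
  set a : ℝ := C * Real.log 2 / 4 with ha
  have ha0 : 0 < a := by positivity
  refine ⟨a, ha0, ?_⟩
  have hlim := (hm a ha0).const_mul Z
  rw [mul_zero] at hlim
  refine squeeze_zero' (.of_forall fun x => by positivity) ?_ hlim
  filter_upwards [eventually_gt_atTop k', eventually_ge_atTop (2 * (K + 2) / C)] with x hx hxC
  have hxk : k < x := hk'.trans_lt hx
  have hz : (x : ℂ) ∈ HalfPlane k := by simpa [HalfPlane] using hxk
  have hKC : (K : ℝ) + 2 ≤ C * x / 2 := by
    rw [div_le_iff₀ hC] at hxC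
    linarith
  have hm0 := (h x hxk).1
  have hLn₀ : L n₀ x ≠ 0 := hL x hz
  set E : ℝ := Real.exp (-(2 * a * x)) with hE
  have hterm : ∀ n : ℕ, n ≠ n₀ →
      ‖f n (x : ℂ) * (L n x / L n₀ x)‖ ≤ m x * E * ((n : ℝ) ^ 2)⁻¹ := by
    intro n hn
    rcases lt_or_gt_of_ne hn with hn | hn
    · rw [hlt n hn x hz, zero_mul, norm_zero]
      positivity
    have hn2 : (2 : ℝ) ≤ n := by exact_mod_cast (by omega : 2 ≤ n)
    have hnpos : (0 : ℝ) < n := by linarith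
    have hE' : (n : ℝ) ^ (-(C * x / 2)) ≤ E := by
      rw [Real.rpow_def_of_pos hnpos, hE]
      refine Real.exp_le_exp.2 ?_
      have : Real.log 2 ≤ Real.log n := Real.log_le_log (by norm_num) hn2
      have h0 : 0 ≤ C * x / 2 := le_trans (by positivity) hKC
      have := mul_le_mul_of_nonneg_right this h0
      rw [ha]
      linarith
    calc ‖f n (x : ℂ) * (L n x / L n₀ x)‖
        = ‖f n (x : ℂ)‖ * (‖L n x‖ / ‖L n₀ x‖) := by rw [norm_mul, norm_div]
      _ ≤ (m x * (n : ℝ) ^ K) * (n : ℝ) ^ (-(C * x)) := by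
          refine mul_le_mul ((h x hxk).2 n) ?_ (by positivity) (by positivity)
          simpa using hLC n hn x hz
      _ = m x * ((n : ℝ) ^ (-(C * x / 2)) * (n : ℝ) ^ ((K : ℝ) - C * x / 2)) := by
          rw [← Real.rpow_natCast, mul_assoc, ← Real.rpow_add hnpos, ← Real.rpow_add hnpos]
          ring_nf
      _ ≤ m x * (E * (n : ℝ) ^ (-2 : ℝ)) := by
          gcongr <;> linarith
      _ = m x * E * ((n : ℝ) ^ 2)⁻¹ := by
          rw [Real.rpow_neg hnpos.le, mul_assoc]
          norm_num
  have hs : HasSum (fun n => f n (x : ℂ) * (L n x / L n₀ x)) 0 := by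
    simpa [mul_div_assoc] using (hsum x hx).div_const (L n₀ x)
  have hs' := hasSum_ite_sub_hasSum hs n₀
  rw [div_self hLn₀, mul_one, zero_sub] at hs'
  have hbound : ‖f n₀ (x : ℂ)‖ ≤ m x * E * Z := by
    rw [← norm_neg]
    refine hs'.norm_le_of_bounded (hZs.hasSum.mul_left (m x * E)) fun n => ?_
    split_ifs with hn
    · rw [norm_zero]
      positivity
    · exact hterm n hn
  calc Real.exp (a * x) * ‖f n₀ (x : ℂ)‖ ≤ Real.exp (a * x) * (m x * E * Z) := by gcongr
    _ = Z * (Real.exp (-a * x) * m x) := by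
      rw [hE, show -a * x = a * x + -(2 * a * x) by ring, Real.exp_add]
      ring

/-- A vanishing series forces all coefficients to vanish. -/
lemma coeff_eq_zero_of_hasSum_zero {k k' : ℝ} (hk' : k ≤ k') {A : Subalgebra ℂ (ℂ → ℂ)}
    (hAB : ∀ f ∈ A, MemBk k f) (hAI : ∀ f ∈ A, MemIk k f → ∀ z ∈ HalfPlane k, f z = 0)
    {L : ℕ → ℂ → ℂ} (hL : MemEtk k L) {f : ArithmeticFunction (ℂ → ℂ)} (hfA : ∀ n, f n ∈ A)
    (hf : PolyGrowth k f)
    (hsum : ∀ x : ℝ, k' < x → HasSum (fun n => f n (x : ℂ) * L n (x : ℂ)) 0) :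
    ∀ n, ∀ z ∈ HalfPlane k, f n z = 0 := by
  intro n
  induction n using Nat.strong_induction_on with
  | _ n ih =>
    obtain rfl | hn := Nat.eq_zero_or_pos n
    · simp
    obtain ⟨C, hC, hLC⟩ := hL.2.2 n hn
    exact hAI _ (hfA n) ⟨(hAB _ (hfA n)).1,
      tendsto_exp_mul_leading_coeff hk' hf (hL.2.1 n hn) hC hLC ih hn hsum⟩

lemma MemHk.polyGrowth {k : ℝ} {A : (ℂ → ℂ) → Prop} {α : ℕ → ℂ → ℂ} (hα : MemHk k A α)
    {f : ArithmeticFunction (ℂ → ℂ)} (hf : ∀ n, 1 ≤ n → f n = α n) : PolyGrowth k f := by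
  obtain ⟨-, M, -, hM0, hM, hlim⟩ := hα
  refine ⟨⌈k⌉₊, fun x => M x, hlim, fun x hx => ?_⟩
  have hz : (x : ℂ) ∈ HalfPlane k := by simpa [HalfPlane] using hx
  refine ⟨hM0 _ hz, fun n => ?_⟩
  obtain rfl | hn := Nat.eq_zero_or_pos n
  · simpa using mul_nonneg (hM0 _ hz) (by positivity)
  rw [hf n hn]
  refine (hM n hn _ hz).trans (mul_le_mul_of_nonneg_left ?_ (hM0 _ hz))
  rw [← Real.rpow_natCast]
  exact Real.rpow_le_rpow_of_exponent_le (by exact_mod_cast hn) (Nat.le_ceil k)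

lemma constArith_eq_arithConst (c : ℂ) : constArith c = arithConst c := rfl

lemma isOpen_halfPlane (k : ℝ) : IsOpen (HalfPlane k) :=
  isOpen_lt continuous_const Complex.continuous_re

lemma eq_zero_of_memOk_of_accPt {k : ℝ} {f : ℂ → ℂ} (hf : MemOk k f) {S : Set ℂ} {z₀ : ℂ}
    (hz₀ : z₀ ∈ HalfPlane k) (hacc : AccPt z₀ (Filter.principal S)) (hS : ∀ z ∈ S, f z = 0) :
    ∀ z ∈ HalfPlane k, f z = 0 := by
  have hfreq := (accPt_iff_frequently_nhdsNE.1 hacc).mono hS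
  exact (hf.analyticOnNhd (isOpen_halfPlane k)).eqOn_zero_of_preconnected_of_frequently_eq_zero
    (convex_halfSpace_re_gt k).isPreconnected hz₀ hfreq

/-- let `A ⊆ (B_k \ I_k) ∪ {0}` be a `ℂ`-subalgebra of `B_k` and `L ∈ Ẽ_k` be
completely multiplicative and not identically zero. Let `α_1, …, α_r ∈ H_k` be such that on a
set `S ⊆ {Re z > k}` with an accumulation point in `{Re z > k}` the sequences
`n ↦ α_j(n)(z)` are algebraically independent over `ℂ` in the Dirichlet-convolution ring.
Then any polynomial relation `∑_{i ∈ I} g_i(z) ∏_j F_L(α_j)(z)^{i_j} = 0` with coefficients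
`g_i ∈ A`, valid on a half-plane `Re z > k' ≥ k` of absolute convergence, forces all `g_i`
to vanish: `F_L(α_1), …, F_L(α_r)` are algebraically independent over `A`. -/
theorem statement_17 (k : ℝ)
    (A : (ℂ → ℂ) → Prop)
    (hAB : ∀ f, A f → MemBk k f)
    (hAI : ∀ f, A f → MemIk k f → ∀ z ∈ HalfPlane k, f z = 0)
    (hAadd : ∀ f g, A f → A g → A (fun z => f z + g z))
    (hAmul : ∀ f g, A f → A g → A (fun z => f z * g z))
    (hAsmul : ∀ (c : ℂ) (f), A f → A (fun z => c * f z))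
    (hAone : A (fun _ => (1 : ℂ)))
    (L : ℕ → ℂ → ℂ) (hL : MemEtk k L)
    (hLmul : ∀ a b : ℕ, 1 ≤ a → 1 ≤ b → ∀ z ∈ HalfPlane k, L (a * b) z = L a z * L b z)
    (hL0 : ∃ n : ℕ, 1 ≤ n ∧ ∃ z ∈ HalfPlane k, L n z ≠ 0)
    (r : ℕ) (α : Fin r → ℕ → ℂ → ℂ) (hα : ∀ j, MemHk k A (α j))
    (S : Set ℂ) (hS : S ⊆ HalfPlane k)
    (hacc : ∃ z₀ ∈ HalfPlane k, AccPt z₀ (Filter.principal S))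
    (halg : ∀ z ∈ S, DirichletAlgInd r (fun j n => α j n z))
    (k' : ℝ) (hk' : k ≤ k')
    (hsum : ∀ j, ∀ z : ℂ, k' < z.re →
      Summable (fun n : ℕ => ‖α j (n + 1) z * L (n + 1) z‖))
    (I : Finset (Fin r → ℕ)) (g : (Fin r → ℕ) → ℂ → ℂ) (hg : ∀ i ∈ I, A (g i))
    (hrel : ∀ z : ℂ, k' < z.re →
      ∑ i ∈ I, g i z * ∏ j, (∑' n : ℕ, α j (n + 1) z * L (n + 1) z) ^ (i j) = 0) :
    ∀ i ∈ I, ∀ z ∈ HalfPlane k, g i z = 0 := by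
  classical
  let A' : Subalgebra ℂ (ℂ → ℂ) :=
    { carrier := {f | A f}
      mul_mem' := fun hf hg => hAmul _ _ hf hg
      add_mem' := fun hf hg => hAadd _ _ hf hg
      algebraMap_mem' := fun c => by
        have := hAsmul c _ hAone
        simp only [mul_one] at this
        exact this }
  let l : ∀ z ∈ HalfPlane k, ℕ →* ℂ := fun z hz =>
    { toFun := fun n => if n = 0 then 0 else L n z
      map_one' := by
        have h := hLmul 1 1 le_rfl le_rfl z hz
        simpa [hL.2.1 1 le_rfl z hz] using h
      map_mul' := fun a b => by
        obtain rfl | ha := Nat.eq_zero_or_pos a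
        · simp
        obtain rfl | hb := Nat.eq_zero_or_pos b
        · simp
        simp [ha.ne', hb.ne', hLmul a b ha hb z hz] }
  let a : Fin r → ArithmeticFunction (ℂ → ℂ) := fun j =>
    ⟨fun n => if n = 0 then 0 else α j n, by simp⟩
  have ha : ∀ j n, 1 ≤ n → a j n = α j n := fun j n hn => if_neg (by omega)
  set f : ArithmeticFunction (ℂ → ℂ) := ∑ i ∈ I, arithConst (g i) * ∏ j, a j ^ i j with hf
  have hA'sub : ∀ f ∈ A', SubExp fun x => ‖f (x : ℂ)‖ := fun f hf => (hAB f hf).2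
  have hconst : ∀ i ∈ I, arithConst (g i) ∈ growthSubsemiring k A' hA'sub := by
    refine fun i hi => ⟨fun n => ?_, PolyGrowth.arithConst (hA'sub _ (hg i hi))⟩
    by_cases hn : n = 1
    · simpa [arithConst, hn] using! hg i hi
    · simp [arithConst, hn]
  have haj : ∀ j, a j ∈ growthSubsemiring k A' hA'sub := by
    refine fun j => ⟨fun n => ?_, (hα j).polyGrowth (ha j)⟩
    obtain rfl | hn := Nat.eq_zero_or_pos n
    · simp
    · rw [ha j n hn]
      exact (hα j).1 n hn
  have hfmem : f ∈ growthSubsemiring k A' hA'sub :=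
    sum_mem fun i hi => mul_mem (hconst i hi) (prod_mem fun j _ => pow_mem (haj j) _)
  have htwist : ∀ (z : ℂ) (l' : ℕ →* ℂ), arithTwist (Pi.evalRingHom (fun _ : ℂ => ℂ) z) l' f =
      ∑ i ∈ I, arithConst (g i z) *
        ∏ j, arithTwist (Pi.evalRingHom (fun _ : ℂ => ℂ) z) l' (a j) ^ i j := fun z l' => by
    simp [hf, map_sum, map_mul, map_prod, map_pow, arithTwist_arithConst]
  have hfsum : ∀ x : ℝ, k' < x → HasSum (fun n => f n (x : ℂ) * L n (x : ℂ)) 0 := by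
    intro x hx
    have hz : (x : ℂ) ∈ HalfPlane k := by simpa [HalfPlane] using hk'.trans_lt hx
    have hxre : k' < (x : ℂ).re := by simpa using hx
    have hlz : ∀ n : ℕ, 1 ≤ n → l x hz n = L n x := fun n hn => if_neg (by omega)
    have hj : ∀ j, HasSum (arithTwist (Pi.evalRingHom (fun _ : ℂ => ℂ) (x : ℂ)) (l x hz) (a j))
        (∑' n : ℕ, α j (n + 1) x * L (n + 1) x) := by
      intro j
      rw [← hasSum_nat_add_iff' 1]
      have h := (hsum j x hxre).of_norm.hasSum
      simpa [ha, hlz] using h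
    have h := hasSum_dirichlet_polynomial I (fun i => g i x) _ _ hj
    rw [hrel x hxre, ← htwist] at h
    convert h using 2 with n
    obtain rfl | hn := Nat.eq_zero_or_pos n
    · simp
    · simp [hlz n hn]
  have hf0 := coeff_eq_zero_of_hasSum_zero hk' (A := A') hAB hAI hL hfmem.1 hfmem.2 hfsum
  obtain ⟨z₀, hz₀, hacc⟩ := hacc
  intro i hi
  refine eq_zero_of_memOk_of_accPt (hAB _ (hg i hi)).1 hz₀ hacc fun z hz => ?_
  refine halg z hz I (fun i => g i z) ?_ i hi
  have haz : ∀ j, arithTwist (Pi.evalRingHom (fun _ : ℂ => ℂ) z) 1 (a j) =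
      toArith fun n => α j n z := fun j => by
    ext n
    rw [arithTwist_apply]
    by_cases hn : n = 0 <;> simp [a, toArith, hn]
  simp only [constArith_eq_arithConst, ← haz]
  rw [← htwist]
  ext n
  simp [hf0 n z (hS hz)]
end
end

section
/- Let k ∈ ℝ, let α_1, …, α_r ∈ D_k be multiplicative arithmetic functions such that e, α_1, …, α_r are pairwise non-equivalent, and let m ≥ 0 be an integer. For 1 ≤ j ≤ r and 0 ≤ i ≤ m let F^{(i)}(α_j) denote the i-th derivative of the Dirichlet series F(α_j)(z) = ∑_{n=1}^∞ α_j(n) n^{−z}, which is holomorphic on Re z > k+1. If g_{j,i} (1 ≤ j ≤ r, 0 ≤ i ≤ m) are entire functions, each admitting constants ρ < 1, A, B > 0 with |g_{j,i}(z)| ≤ A e^{B|z|^ρ} for all z ∈ ℂ (i.e., of order of growth < 1), and ∑_{j=1}^r ∑_{i=0}^m g_{j,i}(z) F^{(i)}(α_j)(z) = 0 for all z with Re z > k+1, then every g_{j,i} is identically zero. In particular the r(m+1) functions F^{(i)}(α_j) are linearly independent over the field of meromorphic functions of order < 1. -/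
open Complex Filter Topology

noncomputable section

/-- Membership in `D_k`: for every `ε > 0` there is `C > 0` with `|α(n)| ≤ C n^(k+ε)` for all
`n ≥ 1`. -/
def MemDk (k : ℝ) (f : ℕ → ℂ) : Prop :=
  ∀ ε : ℝ, 0 < ε → ∃ C : ℝ, 0 < C ∧ ∀ n : ℕ, 1 ≤ n → ‖f n‖ ≤ C * (n : ℝ) ^ (k + ε)

/-- A multiplicative arithmetic function: `α(1) = 1` and `α(mn) = α(m)α(n)` for coprime
`m, n`. -/
def IsMultSeq (f : ℕ → ℂ) : Prop :=
  f 1 = 1 ∧ ∀ m n : ℕ, Nat.Coprime m n → f (m * n) = f m * f n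

/-- Two arithmetic functions are non-equivalent (in the sense of Kaczorowski–Molteni–Perelli)
when they differ at some prime power `p^i` (`i ≥ 1`) for infinitely many primes `p`. -/
def NonEquivSeq (f g : ℕ → ℂ) : Prop :=
  {p : ℕ | p.Prime ∧ ∃ i : ℕ, 1 ≤ i ∧ f (p ^ i) ≠ g (p ^ i)}.Infinite

/-- The identity `e` of the Dirichlet-convolution ring: `e(1) = 1`, `e(n) = 0` for `n ≠ 1`. -/
def eSeq : ℕ → ℂ := fun n => if n = 1 then 1 else 0

/-- An entire function of order of growth `< 1`. -/
def EntireOrderLtOne (g : ℂ → ℂ) : Prop :=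
  Differentiable ℂ g ∧ ∃ ρ A B : ℝ, ρ < 1 ∧ 0 < A ∧ 0 < B ∧
    ∀ z : ℂ, ‖g z‖ ≤ A * Real.exp (B * ‖z‖ ^ ρ)

open Polynomial in
/-- Products of pairwise non-equivalent multiplicative functions with polynomials in `log n` are
linearly independent, even when restricted to the integers coprime to a fixed modulus. -/
theorem eq_zero_of_sum_mul_eval_log {r : ℕ} {α : Fin r → ℕ → ℂ}
    (hmult : ∀ j, IsMultSeq (α j)) (hne_e : ∀ j, NonEquivSeq (α j) eSeq)
    (hne : ∀ j l, j ≠ l → NonEquivSeq (α j) (α l)) (d : Fin r → ℕ) (P : Fin r → ℂ[X])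
    (hdeg : ∀ j, (P j).degree < d j) {M : ℕ} (hM : M ≠ 0)
    (hrel : ∀ n : ℕ, n ≠ 0 → n.Coprime M → ∑ j, α j n * (P j).eval (Real.log n : ℂ) = 0) :
    ∀ j, P j = 0 := by
  have hinf (f f' : ℕ → ℂ) (h : NonEquivSeq f f') :
      ({p : ℕ | p.Prime ∧ ∃ i : ℕ, 1 ≤ i ∧ f (p ^ i) ≠ f' (p ^ i)} \ M.divisors).Infinite :=
    Set.Infinite.sdiff h M.divisors.finite_toSet
  induction hN : ∑ j, d j using Nat.strong_induction_on generalizing d P M with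
  | _ N ih =>
  by_contra! hP
  obtain ⟨j₀, hj₀⟩ := hP
  have hd₀ : d j₀ ≠ 0 := by
    intro h
    have := hdeg j₀
    simp only [h, Nat.cast_zero, Nat.WithBot.lt_zero_iff, degree_eq_bot] at this
    exact hj₀ this
  have hshift (p i : ℕ) (hp : p.Prime) (hpM : ¬ p ∣ M) (j : Fin r) :
      C (α j (p ^ i)) * taylor (Real.log (p ^ i : ℕ) : ℂ) (P j) - C (α j₀ (p ^ i)) * P j = 0 := by
    set q := p ^ i with hq
    set Q : Fin r → ℂ[X] := fun j ↦
      C (α j q) * taylor (Real.log q : ℂ) (P j) - C (α j₀ q) * P j with hQ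
    have hq0 : q ≠ 0 := pow_ne_zero _ hp.ne_zero
    have hpM' : p.Coprime M := (Nat.Prime.coprime_iff_not_dvd hp).2 hpM
    have hlt : ∑ j, Function.update d j₀ (d j₀ - 1) j < N := by
      rw [← hN]
      refine Finset.sum_lt_sum (fun j _ ↦ ?_) ⟨j₀, Finset.mem_univ _, ?_⟩
      · rcases eq_or_ne j j₀ with rfl | h
        · simp
        · simp [h]
      · simp only [Function.update_self]; omega
    refine ih _ hlt (Function.update d j₀ (d j₀ - 1)) Q ?_ (M := M * p)
      (mul_ne_zero hM hp.ne_zero) ?_ (fun f f' h ↦ Set.Infinite.sdiff h (Finset.finite_toSet _))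
      rfl j
    · intro j
      rcases eq_or_ne j j₀ with rfl | h
      · have h1 : Q j = C (α j q) * (taylor (Real.log q : ℂ) (P j) - P j) := by
          simp only [hQ]; ring
        have h2 : (taylor (Real.log q : ℂ) (P j) - P j).degree < (P j).degree :=
          degree_sub_lt_right (degree_taylor _ _) hj₀ (leadingCoeff_taylor _ _)
        have h3 : (Q j).degree < (P j).degree := by
          rw [h1]
          refine lt_of_le_of_lt ?_ h2
          rw [← smul_eq_C_mul]
          exact degree_smul_le _ _
        have h4 := hdeg j
        rw [degree_eq_natDegree hj₀] at h3 h4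
        have h5 : (P j).natDegree < d j := by exact_mod_cast h4
        rw [Function.update_self]
        refine h3.trans_le ?_
        exact_mod_cast (by omega : (P j).natDegree ≤ d j - 1)
      · rw [Function.update_of_ne h]
        refine (degree_sub_le _ _).trans_lt (max_lt ?_ ?_)
        · rw [← smul_eq_C_mul]
          exact (degree_smul_le _ _).trans_lt ((degree_taylor _ _).trans_lt (hdeg j))
        · rw [← smul_eq_C_mul]
          exact (degree_smul_le _ _).trans_lt (hdeg j)
    · intro n hn hnM
      have hnp : p.Coprime n := (Nat.Coprime.coprime_mul_left_right hnM).symm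
      have hnM' : n.Coprime M := Nat.Coprime.coprime_mul_right_right hnM
      have e1 := hrel n hn hnM'
      have e2 := hrel (q * n) (mul_ne_zero hq0 hn)
        (Nat.Coprime.mul_left (Nat.Coprime.pow_left i hpM') hnM')
      have hlog : (Real.log (q * n : ℕ) : ℂ) = Real.log n + Real.log q := by
        rw [Nat.cast_mul, Real.log_mul (by exact_mod_cast hq0) (by exact_mod_cast hn)]
        push_cast
        ring
      rw [hlog] at e2
      have e3 : ∑ j, α j n * (Q j).eval (Real.log n : ℂ)
          = ∑ j, α j (q * n) * (P j).eval (Real.log n + Real.log q : ℂ)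
            - α j₀ q * ∑ j, α j n * (P j).eval (Real.log n : ℂ) := by
        rw [Finset.mul_sum, ← Finset.sum_sub_distrib]
        refine Finset.sum_congr rfl fun j _ ↦ ?_
        rw [(hmult j).2 q n (Nat.Coprime.pow_left i hnp)]
        simp only [hQ, eval_sub, eval_mul, eval_C, taylor_eval]
        ring
      rw [e3, e1, e2, mul_zero, sub_zero]
  have hother (l : Fin r) (hl : l ≠ j₀) : P l = 0 := by
    obtain ⟨p, ⟨hp, i, -, hpi⟩, hpM⟩ := (hinf _ _ (hne l j₀ hl)).nonempty
    have h := congr_arg (fun R ↦ R.coeff (P l).natDegree)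
      (hshift p i hp (fun h ↦ hpM (by simpa using ⟨h, hM⟩)) l)
    simp only [coeff_sub, coeff_C_mul, coeff_taylor_natDegree, coeff_zero, coeff_natDegree,
      ← sub_mul] at h
    exact leadingCoeff_eq_zero.1 ((mul_eq_zero.1 h).resolve_left (sub_ne_zero.2 hpi))
  have hroot (n : ℕ) (hn : n ≠ 0) (hnM : n.Coprime M) (hα : α j₀ n ≠ 0) :
      (P j₀).eval (Real.log n : ℂ) = 0 := by
    have h := hrel n hn hnM
    rw [Finset.sum_eq_single j₀ (fun l _ hl ↦ by simp [hother l hl]) (by simp)] at h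
    exact (mul_eq_zero.1 h).resolve_left hα
  have hS := hinf _ _ (hne_e j₀)
  set S := {p : ℕ | p.Prime ∧ ∃ i : ℕ, 1 ≤ i ∧ α j₀ (p ^ i) ≠ eSeq (p ^ i)} \ M.divisors
  choose! i hi1 hiα using fun p (hp : p ∈ S) ↦ hp.1.2
  refine hj₀ (eq_zero_of_infinite_isRoot _
    (Set.infinite_of_injOn_mapsTo (f := fun p ↦ (Real.log (p ^ i p : ℕ) : ℂ)) ?_ ?_ hS))
  · intro p hp p' hp' h
    have h1 : p ^ i p = p' ^ i p' := by
      have := Real.log_injOn_pos (Set.mem_Ioi.2 (Nat.cast_pos.2 (pow_pos hp.1.1.pos _)))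
        (Set.mem_Ioi.2 (Nat.cast_pos.2 (pow_pos hp'.1.1.pos _))) (Complex.ofReal_injective h)
      exact_mod_cast this
    exact (Nat.prime_dvd_prime_iff_eq hp.1.1 hp'.1.1).1 (hp.1.1.dvd_of_dvd_pow
      (h1 ▸ dvd_pow_self p (by have := hi1 p hp; omega)))
  · intro p hp
    have hpM : ¬ p ∣ M := fun h ↦ hp.2 (by simpa using ⟨h, hM⟩)
    refine hroot _ (pow_ne_zero _ hp.1.1.ne_zero)
      (Nat.Coprime.pow_left _ ((Nat.Prime.coprime_iff_not_dvd hp.1.1).2 hpM)) ?_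
    have h := hiα p hp
    rwa [eSeq, if_neg (Nat.one_lt_pow (by have := hi1 p hp; omega) hp.1.1.one_lt).ne'] at h

/-- An entire function of order `< 1` is of minimal exponential type. -/
theorem EntireOrderLtOne.exists_norm_le_exp {f : ℂ → ℂ} (hf : EntireOrderLtOne f) {ε : ℝ}
    (hε : 0 < ε) : ∃ A : ℝ, 0 ≤ A ∧ ∀ z, ‖f z‖ ≤ A * Real.exp (ε * ‖z‖) := by
  obtain ⟨hd, ρ, A, B, hρ, hA, hB, hb⟩ := hf
  have hlim : ∀ᶠ r : ℝ in atTop, B * r ^ ρ ≤ ε * r := by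
    have h := (tendsto_rpow_neg_atTop (sub_pos.2 hρ)).eventually (gt_mem_nhds (div_pos hε hB))
    filter_upwards [h, eventually_gt_atTop 0] with r hr hr0
    have h1 : r ^ ρ = r ^ (-(1 - ρ)) * r := by
      rw [← Real.rpow_add_one hr0.ne']; ring_nf
    have h2 : B * r ^ (-(1 - ρ)) ≤ ε := by
      rw [mul_comm]; exact ((lt_div_iff₀ hB).1 hr).le
    rw [h1, ← mul_assoc]
    gcongr
  obtain ⟨R, hR⟩ := eventually_atTop.1 hlim
  obtain ⟨C, hC⟩ := (isCompact_closedBall (0 : ℂ) R).exists_bound_of_continuousOn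
    hd.continuous.continuousOn
  refine ⟨max A C, hA.le.trans (le_max_left _ _), fun z ↦ ?_⟩
  rcases le_total R ‖z‖ with h | h
  · refine (hb z).trans ?_
    gcongr ?_ * Real.exp ?_
    · exact le_max_left _ _
    · exact hR _ h
  · have h1 : 1 ≤ Real.exp (ε * ‖z‖) := Real.one_le_exp (by positivity)
    calc ‖f z‖ ≤ max A C * 1 := by
          simpa using Or.inr (hC z (by simpa using h))
      _ ≤ _ := by gcongr

/-- An entire function of minimal exponential type that decays exponentially in a right half-plane
(up to a factor of minimal exponential type) vanishes identically. -/
theorem eq_zero_of_exp_decay {f : ℂ → ℂ} (hf : Differentiable ℂ f) {c : ℝ} (hc : 0 < c)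
    (hb : ∀ ε : ℝ, 0 < ε → ∃ A : ℝ, 0 ≤ A ∧ ∀ z,
      ‖f z‖ ≤ A * Real.exp (ε * ‖z‖ - c * max z.re 0)) (w : ℂ) : f w = 0 := by
  obtain ⟨A, hA, hAb⟩ := hb (c / 8) (by positivity)
  set A' := A * Real.exp (c / 8 * ‖w‖ + c * ‖w‖) with hA'
  have htr (u : ℂ) : ‖f (w + u)‖ ≤ A' * Real.exp (c / 8 * ‖u‖ - c * max u.re 0) := by
    refine (hAb (w + u)).trans ?_
    rw [hA', mul_assoc, ← Real.exp_add]
    gcongr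
    have h1 : ‖w + u‖ ≤ ‖w‖ + ‖u‖ := norm_add_le _ _
    have h2 : max u.re 0 ≤ max (w + u).re 0 + ‖w‖ := by
      have := Complex.abs_re_le_norm w
      have := neg_abs_le w.re
      refine max_le ?_ (by positivity)
      have := le_max_left (w + u).re 0
      simp only [add_re] at this ⊢
      linarith
    nlinarith
  set F : ℂ → ℂ := fun z ↦ f (w + z) * f (w + I * z) * f (w + -z) * f (w + -(I * z)) with hF
  have hFd : Differentiable ℂ F := by fun_prop
  have hFb (z : ℂ) : ‖F z‖ ≤ A' ^ 4 * Real.exp (-(c / 2) * ‖z‖) := by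
    have hA'0 : 0 ≤ A' := by positivity
    calc ‖F z‖ = ‖f (w + z)‖ * ‖f (w + I * z)‖ * ‖f (w + -z)‖ * ‖f (w + -(I * z))‖ := by
          simp [hF]
      _ ≤ A' * Real.exp (c / 8 * ‖z‖ - c * max z.re 0)
            * (A' * Real.exp (c / 8 * ‖I * z‖ - c * max (I * z).re 0))
            * (A' * Real.exp (c / 8 * ‖-z‖ - c * max (-z).re 0))
            * (A' * Real.exp (c / 8 * ‖-(I * z)‖ - c * max (-(I * z)).re 0)) := by
          gcongr <;> exact htr _
      _ = A' ^ 4 * Real.exp (c / 2 * ‖z‖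
            - c * (max z.re 0 + max (-z.im) 0 + max (-z.re) 0 + max z.im 0)) := by
          simp only [norm_neg, norm_mul, norm_I, one_mul, neg_re, I_mul_re, neg_neg]
          rw [show ∀ a b c d : ℝ, A' * a * (A' * b) * (A' * c) * (A' * d)
            = A' ^ 4 * (a * b * c * d) by intros; ring]
          simp only [← Real.exp_add]
          ring_nf
      _ ≤ _ := by
          gcongr
          have h1 := Complex.norm_le_abs_re_add_abs_im z
          have h2 (x : ℝ) : |x| = max x 0 + max (-x) 0 := by
            rcases le_total 0 x with h | h <;> simp [h, abs_of_nonneg, abs_of_nonpos]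
          rw [h2, h2] at h1
          nlinarith
  have hlim : Tendsto F (cocompact ℂ) (𝓝 0) := by
    refine squeeze_zero_norm hFb ?_
    have h1 : Tendsto (fun z : ℂ ↦ -(c / 2) * ‖z‖) (cocompact ℂ) atBot :=
      (tendsto_norm_cocompact_atTop (E := ℂ)).const_mul_atTop_of_neg (by linarith)
    simpa using (Real.tendsto_exp_atBot.comp h1).const_mul (A' ^ 4)
  simpa [hF] using hFd.apply_eq_of_tendsto_cocompact 0 hlim

/-- Uniqueness of the coefficients of a Dirichlet series whose coefficients are themselves entire
functions of minimal exponential type, with polynomial growth in the index. -/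
theorem eq_zero_of_LSeries_eq_zero {h : ℕ → ℂ → ℂ} (hd : ∀ n, Differentiable ℂ (h n)) {K : ℕ}
    (hb : ∀ ε : ℝ, 0 < ε → ∃ A : ℝ, 0 ≤ A ∧ ∀ n : ℕ, n ≠ 0 → ∀ z,
      ‖h n z‖ ≤ A * Real.exp (ε * ‖z‖) * (n : ℝ) ^ K)
    (hz : ∀ z : ℂ, (K : ℝ) + 2 ≤ z.re → LSeries (fun n ↦ h n z) z = 0) {n : ℕ} (hn : n ≠ 0)
    (z : ℂ) : h n z = 0 := by
  induction n using Nat.strong_induction_on generalizing z with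
  | _ n ih =>
  have hn0 : (0 : ℝ) < n := Nat.cast_pos.2 (Nat.pos_of_ne_zero hn)
  set c := Real.log (n + 1) - Real.log n with hc
  have hcpos : 0 < c := sub_pos.2 (Real.log_lt_log hn0 (lt_add_one _))
  obtain ⟨S, hS⟩ := Real.summable_one_div_nat_pow.2 one_lt_two
  have hS0 : 0 ≤ S := hS.nonneg fun _ ↦ by positivity
  refine eq_zero_of_exp_decay (hd n) hcpos (fun ε hε ↦ ?_) z
  obtain ⟨A, hA, hAb⟩ := hb ε hε
  have hfar (z : ℂ) (hre : (K : ℝ) + 2 ≤ z.re) : ‖h n z‖ ≤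
      A * S * (n : ℝ) ^ (K + 2) * Real.exp (c * (K + 2)) * Real.exp (ε * ‖z‖ - c * z.re) := by
    set E := Real.exp (ε * ‖z‖) with hE
    set t := z.re - (K + 2) with ht
    have ht0 : 0 ≤ t := by linarith
    set T := LSeries.term (fun n ↦ h n z) z with hT
    have hterm (l : ℕ) (hl : l ≠ 0) : ‖T l‖ ≤ A * E * ((l : ℝ) ^ (-t) * (1 / (l : ℝ) ^ 2)) := by
      have hl0 : (0 : ℝ) < l := Nat.cast_pos.2 (Nat.pos_of_ne_zero hl)
      rw [hT, LSeries.norm_term_eq, if_neg hl, div_le_iff₀ (by positivity)]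
      refine (hAb l hl z).trans (le_of_eq ?_)
      rw [show z.re = t + (K + 2 : ℕ) by rw [ht]; push_cast; ring, Real.rpow_add hl0,
        Real.rpow_neg hl0.le, Real.rpow_natCast]
      field_simp
      ring
    have hsum : Summable T := by
      refine Summable.of_norm_bounded (hS.summable.mul_left (A * E)) fun l ↦ ?_
      rcases eq_or_ne l 0 with rfl | hl
      · simp [hT]
      · refine (hterm l hl).trans ?_
        gcongr
        refine mul_le_of_le_one_left (by positivity) ?_
        exact Real.rpow_le_one_of_one_le_of_nonpos
          (Nat.one_le_cast.2 (Nat.one_le_iff_ne_zero.2 hl)) (by linarith)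
    have htail : ‖∑' l, if l = n then 0 else T l‖ ≤ A * E * ((n : ℝ) + 1) ^ (-t) * S := by
      refine tsum_of_norm_bounded (hS.mul_left _) fun l ↦ ?_
      rcases eq_or_ne l n with rfl | hln
      · simp only [if_true, norm_zero]; positivity
      rw [if_neg hln]
      rcases eq_or_ne l 0 with rfl | hl
      · simp [hT]
      rcases lt_or_gt_of_ne hln with hlt | hgt
      · have : T l = 0 := by simp [hT, LSeries.term_of_ne_zero hl, ih l hlt hl z]
        rw [this, norm_zero]; positivity
      · refine (hterm l hl).trans ?_
        rw [mul_assoc (A * E)]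
        gcongr A * E * (?_ * _)
        refine Real.rpow_le_rpow_of_nonpos (by positivity) ?_ (by linarith)
        exact_mod_cast hgt
    have h0 : T n = -∑' l, if l = n then 0 else T l := by
      have h1 := hsum.tsum_eq_add_tsum_ite n
      rw [show ∑' l, T l = 0 from hz z hre] at h1
      exact eq_neg_of_add_eq_zero_left h1.symm
    rw [← norm_neg, ← h0, hT, LSeries.norm_term_eq, if_neg hn, div_le_iff₀ (by positivity)] at htail
    refine htail.trans (le_of_eq ?_)
    have hn1 : (0 : ℝ) < n + 1 := by positivity
    have e1 : (n : ℝ) ^ z.re = Real.exp (Real.log n * t) * (n : ℝ) ^ (K + 2) := by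
      rw [← Real.rpow_def_of_pos hn0, ← Real.rpow_natCast, ← Real.rpow_add hn0]
      congr 1; rw [ht]; push_cast; ring
    have e2 : Real.exp (Real.log (n + 1) * -t) * Real.exp (Real.log n * t)
        = Real.exp (c * (K + 2)) * Real.exp (-(c * z.re)) := by
      rw [← Real.exp_add, ← Real.exp_add]
      congr 1; rw [hc, ht]; ring
    rw [e1, Real.rpow_def_of_pos hn1, sub_eq_add_neg, Real.exp_add, ← hE]
    linear_combination A * E * S * (n : ℝ) ^ (K + 2) * e2
  have hnear (z : ℂ) (hre : z.re ≤ (K : ℝ) + 2) : ‖h n z‖ ≤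
      A * (n : ℝ) ^ K * Real.exp (c * (K + 2)) * Real.exp (ε * ‖z‖ - c * max z.re 0) := by
    refine (hAb n hn z).trans ?_
    rw [mul_right_comm, mul_assoc _ (Real.exp (c * (K + 2))), ← Real.exp_add]
    gcongr
    have : max z.re 0 ≤ (K : ℝ) + 2 := max_le hre (by positivity)
    nlinarith
  refine ⟨A * S * (n : ℝ) ^ (K + 2) * Real.exp (c * (K + 2))
    + A * (n : ℝ) ^ K * Real.exp (c * (K + 2)), by positivity, fun z ↦ ?_⟩
  rw [add_mul]
  rcases le_total z.re ((K : ℝ) + 2) with hre | hre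
  · exact (hnear z hre).trans (le_add_of_nonneg_left (by positivity))
  · refine le_add_of_le_of_nonneg ?_ (by positivity)
    have h0 : 0 ≤ z.re := le_trans (by positivity) hre
    rw [max_eq_left h0]
    exact hfar z hre

theorem logMul_iterate_apply (f : ℕ → ℂ) (i n : ℕ) :
    (LSeries.logMul^[i] f) n = (Real.log n : ℂ) ^ i * f n := by
  induction i with
  | zero => simp
  | succ i ih =>
    rw [Function.iterate_succ_apply', LSeries.logMul, ih, ← Complex.natCast_log]
    ring

theorem MemDk.abscissaOfAbsConv_le {k : ℝ} {f : ℕ → ℂ} (hf : MemDk k f) :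
    LSeries.abscissaOfAbsConv f ≤ (k + 2 : ℝ) := by
  obtain ⟨C, -, hC⟩ := hf 1 one_pos
  have := LSeries.abscissaOfAbsConv_le_of_le_const_mul_rpow (f := f) (x := k + 1)
    ⟨C, fun n hn ↦ hC n (Nat.one_le_iff_ne_zero.2 hn)⟩
  refine this.trans (le_of_eq ?_)
  norm_cast
  ring_nf

theorem MemDk.hasSum_iteratedDeriv_LSeries {k : ℝ} {f : ℕ → ℂ} (hf : MemDk k f) (i : ℕ) {z : ℂ}
    (hz : k + 2 < z.re) : LSeriesHasSum (fun n ↦ (-Real.log n : ℂ) ^ i * f n) z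
      (iteratedDeriv i (LSeries f) z) := by
  have habs : LSeries.abscissaOfAbsConv f < z.re :=
    hf.abscissaOfAbsConv_le.trans_lt (EReal.coe_lt_coe hz)
  have hsum : LSeriesSummable (LSeries.logMul^[i] f) z :=
    LSeriesSummable_of_abscissaOfAbsConv_lt_re (by rwa [LSeries.absicssaOfAbsConv_logPowMul])
  rw [LSeries_iteratedDeriv i habs]
  convert hsum.LSeriesHasSum.smul ((-1) ^ i) using 1
  ext n
  rw [Pi.smul_apply, logMul_iterate_apply, smul_eq_mul, neg_pow, mul_assoc]

/-- let `α_1, …, α_r ∈ D_k` be multiplicative with `e, α_1, …, α_r` pairwise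
non-equivalent and let `m ≥ 0`. If entire functions `g_{j,i}` of order `< 1` satisfy
`∑_{j=1}^r ∑_{i=0}^m g_{j,i}(z) F^(i)(α_j)(z) = 0` for `Re z > k+1`, where
`F^(i)(α_j)` is the `i`-th derivative of the Dirichlet series `F(α_j)(z) = ∑ α_j(n) n^(-z)`,
then every `g_{j,i}` is identically zero; in particular the `F^(i)(α_j)` are linearly
independent over the field of meromorphic functions of order `< 1`. -/
theorem statement_18 (k : ℝ) (r m : ℕ) (α : Fin r → ℕ → ℂ)
    (hD : ∀ j, MemDk k (α j))
    (hmult : ∀ j, IsMultSeq (α j))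
    (hne_e : ∀ j, NonEquivSeq (α j) eSeq)
    (hne : ∀ j l, j ≠ l → NonEquivSeq (α j) (α l))
    (g : Fin r → Fin (m + 1) → ℂ → ℂ)
    (hg : ∀ j i, EntireOrderLtOne (g j i))
    (hrel : ∀ z : ℂ, k + 1 < z.re →
      ∑ j, ∑ i : Fin (m + 1), g j i z * iteratedDeriv (i : ℕ) (LSeries (α j)) z = 0) :
    ∀ j i, ∀ z : ℂ, g j i z = 0 := by
  set h : ℕ → ℂ → ℂ := fun n z ↦
    ∑ j, ∑ i : Fin (m + 1), g j i z * ((-Real.log n : ℂ) ^ (i : ℕ) * α j n) with hh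
  set K : ℕ := ⌈|k|⌉₊ + 1 + m with hK
  have hkK : k + 1 ≤ (⌈|k|⌉₊ + 1 : ℕ) := by
    have := Nat.le_ceil |k|
    have := le_abs_self k
    push_cast
    linarith
  have hh0 {n : ℕ} (hn : n ≠ 0) (z : ℂ) : h n z = 0 := by
    refine eq_zero_of_LSeries_eq_zero (K := K) (fun n ↦ ?_) (fun ε hε ↦ ?_) (fun z hz ↦ ?_) hn z
    · have hgd j i : Differentiable ℂ (g j i) := (hg j i).1
      fun_prop
    · choose A hA hAb using fun j i ↦ (hg j i).exists_norm_le_exp hε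
      choose C hC hCb using fun j ↦ hD j 1 one_pos
      refine ⟨∑ j, ∑ i, A j i * C j, Finset.sum_nonneg fun j _ ↦ Finset.sum_nonneg fun i _ ↦
        mul_nonneg (hA j i) (hC j).le, fun n hn z ↦ ?_⟩
      have hn1 : (1 : ℝ) ≤ n := Nat.one_le_cast.2 (Nat.one_le_iff_ne_zero.2 hn)
      simp only [Finset.sum_mul]
      refine norm_sum_le_of_le _ fun j _ ↦ norm_sum_le_of_le _ fun i _ ↦ ?_
      have hlog : ‖(-Real.log n : ℂ) ^ (i : ℕ)‖ ≤ (n : ℝ) ^ m := by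
        have h0 : ‖(-Real.log n : ℂ)‖ ≤ n := by
          rw [norm_neg, Complex.norm_real, Real.norm_of_nonneg (Real.log_nonneg hn1)]
          exact Real.log_le_self (by positivity)
        rw [norm_pow]
        exact (pow_le_pow_left₀ (norm_nonneg _) h0 _).trans
          (pow_le_pow_right₀ hn1 (Nat.lt_succ_iff.1 i.2))
      have hα : ‖α j n‖ ≤ C j * (n : ℝ) ^ (⌈|k|⌉₊ + 1) := by
        refine (hCb j n (Nat.one_le_iff_ne_zero.2 hn)).trans ?_
        rw [← Real.rpow_natCast]
        exact mul_le_mul_of_nonneg_left (Real.rpow_le_rpow_of_exponent_le hn1 hkK) (hC j).le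
      calc ‖g j i z * ((-Real.log n : ℂ) ^ (i : ℕ) * α j n)‖
          ≤ A j i * Real.exp (ε * ‖z‖) * ((n : ℝ) ^ m * (C j * (n : ℝ) ^ (⌈|k|⌉₊ + 1))) := by
            rw [norm_mul, norm_mul]
            have := hA j i
            have := hAb j i z
            gcongr
        _ = A j i * C j * Real.exp (ε * ‖z‖) * (n : ℝ) ^ K := by
            rw [hK, pow_add _ _ m]; ring
    · have hkz : k + 2 < z.re := by
        rw [hK] at hz
        push_cast at hz hkK
        have : (0 : ℝ) ≤ m := m.cast_nonneg
        linarith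
      have hsum := LSeriesHasSum.sum (S := Finset.univ) fun j _ ↦
        LSeriesHasSum.sum (S := Finset.univ) fun i _ ↦
          ((hD j).hasSum_iteratedDeriv_LSeries ((i : Fin (m + 1)) : ℕ) hkz).smul (g j i z)
      rw [hrel z (by linarith)] at hsum
      rw [← hsum.LSeries_eq]
      congr 1
      ext n
      simp [hh, Finset.sum_apply]
  intro j i z
  have hP := eq_zero_of_sum_mul_eval_log hmult hne_e hne (fun _ ↦ m + 1)
    (fun j ↦ ∑ i : Fin (m + 1), Polynomial.C (g j i z * (-1) ^ (i : ℕ)) * Polynomial.X ^ (i : ℕ))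
    (fun j ↦ Polynomial.degree_sum_fin_lt _) one_ne_zero (fun n hn _ ↦ ?_) j
  · have hcoeff := congr_arg (fun R ↦ R.coeff (i : ℕ)) hP
    simp only [Polynomial.finsetSum_coeff, Polynomial.coeff_C_mul, Polynomial.coeff_X_pow,
      Polynomial.coeff_zero, Fin.val_inj] at hcoeff
    simpa using hcoeff
  · rw [← hh0 hn z]
    refine Finset.sum_congr rfl fun j _ ↦ ?_
    rw [Polynomial.eval_finsetSum, Finset.mul_sum]
    refine Finset.sum_congr rfl fun i _ ↦ ?_
    rw [neg_pow (Real.log n : ℂ)]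
    simp only [Polynomial.eval_mul, Polynomial.eval_C, Polynomial.eval_pow, Polynomial.eval_X]
    ring
end
end

section
/- Let k ∈ ℝ and let α_1, …, α_r ∈ D_k be multiplicative arithmetic functions that are algebraically independent over ℂ in the Dirichlet-convolution ring of arithmetic functions. Then the Dirichlet series F(α_1), …, F(α_r), holomorphic on Re z > k+1, are algebraically independent over the field of meromorphic functions of order < 1: for every finite set I ⊆ ℕ^r and entire functions g_i (i ∈ I), each admitting constants ρ < 1, A, B > 0 with |g_i(z)| ≤ A e^{B|z|^ρ} for all z ∈ ℂ, if ∑_{i=(i_1,…,i_r)∈I} g_i(z) F(α_1)(z)^{i_1} ⋯ F(α_r)(z)^{i_r} = 0 for all Re z > k+1, then g_i = 0 for all i ∈ I. -/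
open Complex Filter Topology

noncomputable section

/-- `f` has at most order `1` and minimal type. -/
def HasZeroExpType (f : ℂ → ℂ) : Prop :=
  ∀ ε : ℝ, 0 < ε → ∃ C : ℝ, ∀ z : ℂ, ‖f z‖ ≤ C * Real.exp (ε * ‖z‖)

lemma EntireOrderLtOne.hasZeroExpType {g : ℂ → ℂ} (hg : EntireOrderLtOne g) :
    HasZeroExpType g := by
  obtain ⟨hd, ρ, A, B, hρ, hA, hB, hb⟩ := hg
  intro ε hε
  have h1 := (tendsto_rpow_neg_atTop (sub_pos.2 hρ)).eventually_le_const (div_pos hε hB)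
  obtain ⟨R, hR⟩ := eventually_atTop.1 (h1.and (eventually_gt_atTop 0))
  obtain ⟨M, hM⟩ := (isCompact_closedBall (0 : ℂ) R).exists_bound_of_continuousOn
    hd.continuous.continuousOn
  refine ⟨max A M, fun z => ?_⟩
  have hmax : 0 ≤ max A M := hA.le.trans (le_max_left _ _)
  rcases le_total ‖z‖ R with hz | hz
  · have h2 : 1 ≤ Real.exp (ε * ‖z‖) := Real.one_le_exp (by positivity)
    calc ‖g z‖ ≤ max A M := (hM z (by simpa using hz)).trans (le_max_right _ _)
      _ ≤ _ := le_mul_of_one_le_right hmax h2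
  · obtain ⟨h2, hz0⟩ := hR _ hz
    have h3 : B * ‖z‖ ^ ρ ≤ ε * ‖z‖ := by
      calc B * ‖z‖ ^ ρ = B * (‖z‖ ^ (-(1 - ρ)) * ‖z‖) := by
            rw [← Real.rpow_add_one hz0.ne']; ring_nf
        _ ≤ B * (ε / B * ‖z‖) := by gcongr
        _ = ε * ‖z‖ := by field_simp
    calc ‖g z‖ ≤ A * Real.exp (B * ‖z‖ ^ ρ) := hb z
      _ ≤ _ := by gcongr; exact le_max_left _ _

lemma HasZeroExpType.sum_mul_const {ι : Type*} {I : Finset ι} {g : ι → ℂ → ℂ}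
    (hg : ∀ i ∈ I, HasZeroExpType (g i)) (c : ι → ℂ) :
    HasZeroExpType (fun z => ∑ i ∈ I, g i z * c i) := by
  intro ε hε
  choose! C hC using fun i hi => hg i hi ε hε
  refine ⟨∑ i ∈ I, C i * ‖c i‖, fun z => ?_⟩
  rw [Finset.sum_mul]
  refine norm_sum_le_of_le _ fun i hi => ?_
  rw [norm_mul, mul_right_comm]
  gcongr
  exact hC i hi z

lemma HasZeroExpType.comp_const_mul {f : ℂ → ℂ} (hf : HasZeroExpType f) (u : ℂ) :
    HasZeroExpType (fun z => f (u * z)) := by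
  intro ε hε
  obtain ⟨C, hC⟩ := hf (ε / (‖u‖ + 1)) (by positivity)
  have hC0 : 0 ≤ C := by simpa using (norm_nonneg _).trans (hC 0)
  refine ⟨C, fun z => (hC _).trans ?_⟩
  refine mul_le_mul_of_nonneg_left (Real.exp_le_exp.2 ?_) hC0
  rw [norm_mul, div_mul_eq_mul_div, div_le_iff₀ (by positivity)]
  nlinarith [mul_nonneg hε.le (norm_nonneg z)]

/-- `f` decays exponentially along the positive real axis. -/
def HasExpDecay (f : ℂ → ℂ) : Prop :=
  ∃ C c : ℝ, 0 < c ∧ ∀ x : ℝ, 0 ≤ x → ‖f x‖ ≤ C * Real.exp (-c * x)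

/-- A Phragmén–Lindelöf bound in the first quadrant. -/
lemma HasZeroExpType.quadrant_bound {f : ℂ → ℂ} (hf : HasZeroExpType f)
    (hd : Differentiable ℂ f) {C c : ℝ} (hc : 0 < c)
    (hdec : ∀ x : ℝ, 0 ≤ x → ‖f x‖ ≤ C * Real.exp (-c * x)) {ε : ℝ} (hε : 0 < ε) :
    ∃ M : ℝ, ∀ z : ℂ, 0 ≤ z.re → 0 ≤ z.im → ‖f z‖ ≤ M * Real.exp (-c * z.re + ε * z.im) := by
  obtain ⟨D, hD⟩ := hf ε hε
  have hnorm (z : ℂ) : ‖cexp ((c + ε * I) * z)‖ = Real.exp (c * z.re - ε * z.im) := by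
    rw [Complex.norm_exp]; simp
  have hD0 : 0 ≤ D := by simpa using (norm_nonneg _).trans (hD 0)
  refine ⟨max C D, fun z hz1 hz2 => ?_⟩
  have key : ‖f z * cexp ((c + ε * I) * z)‖ ≤ max C D := by
    refine PhragmenLindelof.quadrant_I (f := fun z => f z * cexp ((c + ε * I) * z))
      (Differentiable.diffContOnCl (by fun_prop)) ⟨1, by norm_num, ε + (c + ε), ?_⟩ ?_ ?_ hz1 hz2
    · refine Asymptotics.IsBigO.of_bound D (Eventually.of_forall fun w => ?_)
      rw [norm_mul, hnorm, Real.rpow_one, Real.norm_of_nonneg (Real.exp_pos _).le, add_mul,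
        Real.exp_add, ← mul_assoc]
      gcongr
      · exact hD w
      · nlinarith [(abs_le.1 (Complex.abs_re_le_norm w)).2, (abs_le.1 (Complex.abs_im_le_norm w)).1]
    · intro x hx
      rw [norm_mul, hnorm]
      refine le_trans ?_ (le_max_left _ _)
      calc ‖f x‖ * _ ≤ C * Real.exp (-c * x) * Real.exp (c * x - ε * 0) := by
            simpa using mul_le_mul_of_nonneg_right (hdec x hx) (Real.exp_pos _).le
        _ = C := by rw [mul_assoc, ← Real.exp_add]; simp
    · intro x hx
      rw [norm_mul, hnorm]
      refine le_trans ?_ (le_max_right _ _)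
      calc ‖f (x * I)‖ * _ ≤ D * Real.exp (ε * x) * Real.exp (-(ε * x)) := by
            have := hD (x * I)
            simp only [norm_mul, Complex.norm_real, Complex.norm_I, mul_one,
              Real.norm_of_nonneg hx] at this
            simpa using mul_le_mul_of_nonneg_right this (Real.exp_pos _).le
        _ = D := by rw [mul_assoc, ← Real.exp_add]; simp
  rw [norm_mul, hnorm] at key
  calc ‖f z‖ = ‖f z‖ * Real.exp (c * z.re - ε * z.im) * Real.exp (-c * z.re + ε * z.im) := by
        rw [mul_assoc, ← Real.exp_add]; ring_nf; simp
    _ ≤ _ := by gcongr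

lemma HasExpDecay.sector {f : ℂ → ℂ} (hf : HasZeroExpType f) (hd : Differentiable ℂ f)
    (hdec : HasExpDecay f) :
    HasExpDecay (fun z => f ((1 + I) * z)) ∧
      ∃ M : ℝ, ∀ z : ℂ, 0 ≤ z.im → z.im ≤ z.re → ‖f z‖ ≤ M := by
  obtain ⟨C, c, hc, hdec⟩ := hdec
  obtain ⟨M, hM⟩ := hf.quadrant_bound hd hc hdec (half_pos hc)
  have hM0 : 0 ≤ M := by simpa using (norm_nonneg _).trans (hM 0 le_rfl le_rfl)
  refine ⟨⟨M, c / 2, half_pos hc, fun x hx => ?_⟩, M, fun z h1 h2 => ?_⟩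
  · convert hM ((1 + I) * x) (by simpa) (by simpa) using 3
    simp
    ring
  · refine (hM z (h1.trans h2) h1).trans (mul_le_of_le_one_right hM0 ?_)
    rw [Real.exp_le_one_iff]
    nlinarith

lemma HasExpDecay.quadrant {f : ℂ → ℂ} (hf : HasZeroExpType f) (hd : Differentiable ℂ f)
    (hdec : HasExpDecay f) :
    HasExpDecay (fun z => f (I * z)) ∧
      ∃ M : ℝ, ∀ z : ℂ, 0 ≤ z.re → 0 ≤ z.im → ‖f z‖ ≤ M := by
  obtain ⟨hdec1, M1, hM1⟩ := hdec.sector hf hd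
  obtain ⟨hdec2, M2, hM2⟩ := hdec1.sector (hf.comp_const_mul _) (by fun_prop)
  refine ⟨?_, max M1 M2, fun z hre him => ?_⟩
  · obtain ⟨C, c, hc, h⟩ := hdec2
    refine ⟨C, c / 2, half_pos hc, fun x hx => ?_⟩
    have hI : (1 + I) * ((1 + I) * ((x / 2 : ℝ) : ℂ)) = I * x := by
      push_cast
      linear_combination (x / 2 : ℂ) * I_sq
    have := h (x / 2) (by positivity)
    simp only [hI] at this
    convert this using 3
    ring
  · rcases le_total z.im z.re with h | h
    · exact (hM1 z him h).trans (le_max_left _ _)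
    · have hz : (1 + I) * ((1 - I) / 2 * z) = z := by
        linear_combination (-z / 2) * I_sq
      have hw : (1 - I) / 2 * z = ⟨(z.re + z.im) / 2, (z.im - z.re) / 2⟩ := by
        apply Complex.ext <;> simp <;> ring
      have := hM2 ((1 - I) / 2 * z) (by rw [hw]; simp only; linarith)
        (by rw [hw]; simp only; linarith)
      simp only [hz] at this
      exact this.trans (le_max_right _ _)

/-- An entire function of order `1` and minimal type which decays exponentially along the
positive real axis vanishes. -/
lemma HasExpDecay.eq_zero {f : ℂ → ℂ} (hdec : HasExpDecay f) (hf : HasZeroExpType f)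
    (hd : Differentiable ℂ f) (z : ℂ) : f z = 0 := by
  obtain ⟨hdec1, M1, hM1⟩ := hdec.quadrant hf hd
  obtain ⟨hdec2, M2, hM2⟩ := hdec1.quadrant (hf.comp_const_mul _) (by fun_prop)
  obtain ⟨hdec3, M3, hM3⟩ := hdec2.quadrant ((hf.comp_const_mul _).comp_const_mul _) (by fun_prop)
  obtain ⟨-, M4, hM4⟩ := hdec3.quadrant
    (((hf.comp_const_mul _).comp_const_mul _).comp_const_mul _) (by fun_prop)
  have hbdd : ∀ w, ‖f w‖ ≤ max (max M1 M2) (max M3 M4) := by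
    intro w
    rcases le_total 0 w.re with hre | hre <;> rcases le_total 0 w.im with him | him
    · exact (hM1 w hre him).trans (by simp)
    · have := hM4 (I * w) (by simpa) (by simpa)
      rw [show I * (I * (I * (I * w))) = w by simp [← mul_assoc]] at this
      exact this.trans (by simp)
    · have := hM2 (-I * w) (by simpa) (by simpa)
      rw [show I * (-I * w) = w by simp [← mul_assoc]] at this
      exact this.trans (by simp)
    · have := hM3 (-w) (by simpa) (by simpa)
      rw [show I * (I * -w) = w by simp [← mul_assoc]] at this
      exact this.trans (by simp)
  have hconst : ∀ w, f w = f z := fun w => hd.apply_eq_apply_of_bounded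
    (isBounded_iff_forall_norm_le.2 ⟨_, by rintro _ ⟨w, rfl⟩; exact hbdd w⟩) w z
  obtain ⟨C, c, hc, h⟩ := hdec
  have hlim : Tendsto (fun x : ℝ => C * Real.exp (-c * x)) atTop (𝓝 0) := by
    have : Tendsto (fun x : ℝ => -c * x) atTop atBot :=
      tendsto_id.const_mul_atTop_of_neg (neg_neg_of_pos hc)
    simpa using (Real.tendsto_exp_atBot.comp this).const_mul C
  refine norm_le_zero_iff.1 (ge_of_tendsto hlim ?_)
  filter_upwards [eventually_ge_atTop 0] with x hx
  simpa only [hconst x] using h x hx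

lemma hasExpDecay_of_forall_ge {f : ℂ → ℂ} (hf : HasZeroExpType f) {C c a : ℝ} (hc : 0 < c)
    (h : ∀ x : ℝ, a ≤ x → ‖f x‖ ≤ C * Real.exp (-c * x)) : HasExpDecay f := by
  obtain ⟨D, hD⟩ := hf 1 one_pos
  have hD0 : 0 ≤ D := by simpa using (norm_nonneg _).trans (hD 0)
  refine ⟨max C (D * Real.exp ((1 + c) * a)), c, hc, fun x hx => ?_⟩
  rcases le_total a x with hax | hax
  · refine (h x hax).trans ?_
    gcongr
    exact le_max_left _ _
  · calc ‖f x‖ ≤ D * Real.exp (1 * x) := by simpa [abs_of_nonneg hx] using hD x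
      _ ≤ D * Real.exp ((1 + c) * a + -c * x) := by
        gcongr
        nlinarith
      _ = D * Real.exp ((1 + c) * a) * Real.exp (-c * x) := by rw [Real.exp_add, mul_assoc]
      _ ≤ _ := by gcongr; exact le_max_right _ _

/-- Tails of Dirichlet series decay exponentially along the real axis. -/
lemma norm_LSeries_sub_sum_le {b : ℕ → ℂ} {a : ℝ} (hb : LSeriesSummable b a) (n : ℕ) {x : ℝ}
    (hx : a ≤ x) :
    ‖LSeries b x - ∑ m ∈ Finset.range (n + 1), LSeries.term b x m‖ ≤
      (∑' m, ‖LSeries.term b a m‖) * ((n : ℝ) + 1) ^ (a - x) := by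
  have hs : LSeriesSummable b x := hb.of_re_le_re (by simpa)
  have hsplit := hs.sum_add_tsum_nat_add (n + 1)
  rw [LSeries, ← hsplit, add_sub_cancel_left]
  have hterm (m : ℕ) : ‖LSeries.term b x (m + (n + 1))‖ ≤
      ‖LSeries.term b a (m + (n + 1))‖ * ((n : ℝ) + 1) ^ (a - x) := by
    have h0 : (0 : ℝ) < ((m + (n + 1) : ℕ) : ℝ) := by positivity
    rw [LSeries.norm_term_eq, LSeries.norm_term_eq, if_neg (by omega), if_neg (by omega),
      ofReal_re, ofReal_re, div_mul_eq_mul_div, mul_div_assoc, div_eq_mul_inv]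
    gcongr
    rw [le_div_iff₀ (by positivity), inv_mul_eq_div, ← Real.rpow_sub h0]
    exact Real.rpow_le_rpow_of_nonpos (by positivity) (by push_cast; linarith) (by linarith)
  have hsum := (summable_nat_add_iff (n + 1)).2 hb.norm
  refine (tsum_of_norm_bounded (hsum.mul_right _).hasSum hterm).trans ?_
  rw [tsum_mul_right]
  refine mul_le_mul_of_nonneg_right ?_ (by positivity)
  rw [← hb.norm.sum_add_tsum_nat_add (n + 1)]
  exact le_add_of_nonneg_left (by positivity)

/-- A relation between Dirichlet series with entire coefficients of order `1` and minimal type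
holds coefficientwise. -/
lemma sum_mul_coeff_eq_zero {ι : Type*} {I : Finset ι} {b : ι → ℕ → ℂ} {g : ι → ℂ → ℂ} {a : ℝ}
    (hd : ∀ i ∈ I, Differentiable ℂ (g i)) (hg : ∀ i ∈ I, HasZeroExpType (g i))
    (hb : ∀ i ∈ I, LSeriesSummable (b i) a)
    (hrel : ∀ x : ℝ, a ≤ x → ∑ i ∈ I, g i x * LSeries (b i) x = 0) (n : ℕ) (hn : n ≠ 0) (z : ℂ) :
    ∑ i ∈ I, g i z * b i n = 0 := by
  induction n using Nat.strong_induction_on generalizing z with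
  | _ n ih =>
  have hz := HasZeroExpType.sum_mul_const hg (fun i => b i n)
  refine HasExpDecay.eq_zero (f := fun z => ∑ i ∈ I, g i z * b i n) ?_ hz
    (Differentiable.fun_sum fun i hi => (hd i hi).mul_const _) z
  have hn0 : (0 : ℝ) < n := by positivity
  set c := (Real.log (n + 1) - Real.log n) / 2 with hcdef
  have hc : 0 < c := half_pos (sub_pos.2 (Real.log_lt_log hn0 (by linarith)))
  choose! C hC using fun i hi => hg i hi c hc
  set K := fun i => ∑' m, ‖LSeries.term (b i) a m‖
  refine hasExpDecay_of_forall_ge hz (a := max a 0)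
    (C := (∑ i ∈ I, C i * K i) * ((n : ℝ) + 1) ^ a) hc fun x hx => ?_
  obtain ⟨hxa, hx0⟩ := max_le_iff.1 hx
  have hmain : ∑ i ∈ I, g i x * ∑ m ∈ Finset.range (n + 1), LSeries.term (b i) x m =
      (∑ i ∈ I, g i x * b i n) / (n : ℂ) ^ (x : ℂ) := by
    simp_rw [Finset.mul_sum]
    rw [Finset.sum_comm, Finset.sum_range_succ, Finset.sum_eq_zero, zero_add, Finset.sum_div]
    · simp [LSeries.term_of_ne_zero hn, mul_div_assoc]
    · intro m hm
      rcases eq_or_ne m 0 with rfl | hm0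
      · simp
      · simp only [LSeries.term_of_ne_zero hm0, ← mul_div_assoc, ← Finset.sum_div]
        rw [ih m (Finset.mem_range.1 hm) hm0, zero_div]
  have htail : (∑ i ∈ I, g i x * b i n) / (n : ℂ) ^ (x : ℂ) = -∑ i ∈ I, g i x *
      (LSeries (b i) x - ∑ m ∈ Finset.range (n + 1), LSeries.term (b i) x m) := by
    simp_rw [mul_sub]
    rw [Finset.sum_sub_distrib, hrel x hxa, hmain]
    ring
  have hbound : ‖(∑ i ∈ I, g i x * b i n) / (n : ℂ) ^ (x : ℂ)‖ ≤
      (∑ i ∈ I, C i * K i) * Real.exp (c * x) * ((n : ℝ) + 1) ^ (a - x) := by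
    rw [htail, norm_neg, Finset.sum_mul, Finset.sum_mul]
    refine norm_sum_le_of_le _ fun i hi => ?_
    have h1 := norm_LSeries_sub_sum_le (hb i hi) n hxa
    have h2 : ‖g i x‖ ≤ C i * Real.exp (c * x) := by
      simpa [abs_of_nonneg hx0] using hC i hi x
    rw [norm_mul]
    calc _ ≤ (C i * Real.exp (c * x)) * (K i * ((n : ℝ) + 1) ^ (a - x)) :=
          mul_le_mul h2 h1 (norm_nonneg _) ((norm_nonneg _).trans h2)
      _ = _ := by ring
  rw [norm_div, Complex.norm_natCast_cpow_of_pos (Nat.pos_of_ne_zero hn), ofReal_re,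
    div_le_iff₀ (by positivity)] at hbound
  refine hbound.trans (le_of_eq ?_)
  have hexp : Real.exp (c * x) * (((n : ℝ) + 1) ^ (-x) * (n : ℝ) ^ x) = Real.exp (-c * x) := by
    rw [Real.rpow_def_of_pos hn0, Real.rpow_def_of_pos (by positivity), ← Real.exp_add,
      ← Real.exp_add, hcdef]
    ring_nf
  rw [← hexp, sub_eq_add_neg, Real.rpow_add (by positivity)]
  ring

lemma LSeriesHasSum_arith_one (s : ℂ) : LSeriesHasSum (⇑(1 : ArithmeticFunction ℂ)) s 1 := by
  unfold LSeriesHasSum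
  convert hasSum_ite_eq 1 (1 : ℂ) using 1
  ext n
  by_cases hn : n = 1 <;> simp [LSeries.term, hn]

lemma LSeriesHasSum_arith_pow {f : ArithmeticFunction ℂ} {s a : ℂ} (hf : LSeriesHasSum (⇑f) s a)
    (n : ℕ) : LSeriesHasSum (⇑(f ^ n)) s (a ^ n) := by
  induction n with
  | zero => simpa using LSeriesHasSum_arith_one s
  | succ n ih => simpa only [pow_succ] using ArithmeticFunction.LSeriesHasSum_mul ih hf

lemma LSeriesHasSum_arith_prod {ι : Type*} (J : Finset ι) {f : ι → ArithmeticFunction ℂ}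
    {s : ℂ} {a : ι → ℂ} (hf : ∀ j, LSeriesHasSum (⇑(f j)) s (a j)) :
    LSeriesHasSum (⇑(∏ j ∈ J, f j)) s (∏ j ∈ J, a j) := by
  classical
  induction J using Finset.induction_on with
  | empty => simpa using LSeriesHasSum_arith_one s
  | insert j J hj ih =>
    simpa only [Finset.prod_insert hj] using ArithmeticFunction.LSeriesHasSum_mul (hf j) ih

lemma MemDk.LSeriesSummable {k : ℝ} {f : ℕ → ℂ} (hf : MemDk k f) {s : ℂ} (hs : k + 1 < s.re) :
    LSeriesSummable f s := by
  obtain ⟨C, -, hC⟩ := hf ((s.re - (k + 1)) / 2) (by linarith)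
  refine LSeriesSummable_of_le_const_mul_rpow (x := k + (s.re - (k + 1)) / 2 + 1) (by linarith)
    ⟨C, fun n hn => ?_⟩
  rw [add_sub_cancel_right]
  exact hC n (Nat.one_le_iff_ne_zero.2 hn)

lemma MemDk.LSeriesHasSum_toArith {k : ℝ} {f : ℕ → ℂ} (hf : MemDk k f) {s : ℂ}
    (hs : k + 1 < s.re) : LSeriesHasSum (⇑(toArith f)) s (LSeries f s) := by
  refine (LSeriesHasSum_congr s _ fun {n} hn => ?_).2 (hf.LSeriesSummable hs).LSeriesHasSum
  simp [toArith, hn]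

lemma arith_sum_apply {ι : Type*} (I : Finset ι) (f : ι → ArithmeticFunction ℂ) (n : ℕ) :
    (∑ i ∈ I, f i) n = ∑ i ∈ I, f i n :=
  map_sum (⟨⟨fun f => f n, by simp⟩, by simp⟩ : ArithmeticFunction ℂ →+ ℂ) f I

lemma constArith_mul_apply (c : ℂ) (f : ArithmeticFunction ℂ) (n : ℕ) :
    (constArith c * f) n = c * f n := by
  have : constArith c = c • (1 : ArithmeticFunction ℂ) := by
    ext m
    simp [constArith, ArithmeticFunction.one_apply]
  rw [this, smul_mul_assoc, one_mul]
  simp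

/-- if `α_1, …, α_r ∈ D_k` are multiplicative arithmetic functions,
algebraically independent over `ℂ` in the Dirichlet-convolution ring, then their Dirichlet
series `F(α_j)(z) = ∑ α_j(n) n^(-z)` are algebraically independent over the field of
meromorphic functions of order `< 1`: any relation
`∑_{i ∈ I} g_i(z) F(α_1)(z)^{i_1} ⋯ F(α_r)(z)^{i_r} = 0` on `Re z > k+1`, with entire
coefficients `g_i` of order `< 1`, forces every `g_i` to vanish identically. -/
theorem statement_19 (k : ℝ) (r : ℕ) (α : Fin r → ℕ → ℂ)
    (hD : ∀ j, MemDk k (α j))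
    (hmult : ∀ j, IsMultSeq (α j))
    (halg : DirichletAlgInd r α)
    (I : Finset (Fin r → ℕ)) (g : (Fin r → ℕ) → ℂ → ℂ)
    (hg : ∀ i ∈ I, EntireOrderLtOne (g i))
    (hrel : ∀ z : ℂ, k + 1 < z.re →
      ∑ i ∈ I, g i z * ∏ j, (LSeries (α j) z) ^ (i j) = 0) :
    ∀ i ∈ I, ∀ z : ℂ, g i z = 0 := by
  intro i hi z
  set b : (Fin r → ℕ) → ArithmeticFunction ℂ := fun i => ∏ j, toArith (α j) ^ i j
  have hb (i : Fin r → ℕ) {s : ℂ} (hs : k + 1 < s.re) :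
      LSeriesHasSum (⇑(b i)) s (∏ j, LSeries (α j) s ^ i j) :=
    LSeriesHasSum_arith_prod _ fun j => LSeriesHasSum_arith_pow ((hD j).LSeriesHasSum_toArith hs) _
  have hcoeff := sum_mul_coeff_eq_zero (b := fun i => ⇑(b i)) (a := k + 2)
    (fun i hi => (hg i hi).1) (fun i hi => (hg i hi).hasZeroExpType)
    (fun i _ => (hb i (by rw [ofReal_re]; linarith)).LSeriesSummable) fun x hx => by
      have hx' : k + 1 < (x : ℂ).re := by rw [ofReal_re]; linarith
      simpa only [(hb _ hx').LSeries_eq] using hrel x hx'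
  refine halg I (fun i => g i z) ?_ i hi
  ext n
  rcases eq_or_ne n 0 with rfl | hn
  · simp
  · rw [arith_sum_apply]
    simp only [constArith_mul_apply, ArithmeticFunction.zero_apply]
    exact hcoeff n hn z
end
end
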